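/- Let q be a power of 2, n ≥ 1, let V̄ be a non-degenerate quadratic space of dimension 2n over 𝐅̄_q, and let T̄ ∈ 𝔬(V̄) be nilpotent with symbol (λ_i, χ_i, m_i)_{1≤i≤k}; with χ_{k+1} := 0, set n₂ = #{1 ≤ i ≤ k : χ_i + χ_{i+1} ≤ λ_i and χ_i ≠ λ_i/2}. For ε ∈ {+,−}, let N^ε be the set of nilpotent T′ ∈ 𝔬^ε_{2n}(𝐅_q) whose scalar extension to 𝐅̄_q is isomorphic to (V̄, T̄) as a form module. (a) If χ_i = λ_i/2 for all i, then N^+ is a single O^+_{2n}(𝐅_q)-orbit. (b) Otherwise, N^+ is a union of exactly 2^{n₂−1} O^+_{2n}(𝐅_q)-orbits and N^- is a union of exactly 2^{n₂−1} O^-_{2n}(𝐅_q)-orbits. -/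

import Mathlib

open Module Finset

/-- The radical `V^⊥ = {v | ⟨v,w⟩ = 0 for all w}` of the polar form of `Q`. -/
def QuadraticForm.polarRadical {F V : Type*} [Field F] [AddCommGroup V] [Module F V]
    (Q : QuadraticForm F V) : Submodule F V :=
  LinearMap.ker (QuadraticMap.polarBilin Q)

/-- A quadratic space `(V, Q)` (in characteristic 2) is non-degenerate if `V ≠ 0`,
`dim V^⊥ ≤ 1` and `Q(v) ≠ 0` for every nonzero `v ∈ V^⊥`. -/
def QuadraticForm.IsNondegenerateFormSpace {F V : Type*} [Field F] [AddCommGroup V] [Module F V]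
    (Q : QuadraticForm F V) : Prop :=
  Nontrivial V ∧ Module.finrank F Q.polarRadical ≤ 1 ∧
    ∀ v ∈ Q.polarRadical, v ≠ 0 → Q v ≠ 0

/-- Membership in the orthogonal Lie algebra
`𝔬(V) = {x ∈ End(V) | ⟨xv, v⟩ = 0 ∀ v, tr x = 0}`. -/
def QuadraticForm.mem_oLie {F V : Type*} [Field F] [AddCommGroup V] [Module F V]
    (Q : QuadraticForm F V) (x : Module.End F V) : Prop :=
  (∀ v : V, QuadraticMap.polar Q (x v) v = 0) ∧ LinearMap.trace F V x = 0

/-- Two endomorphisms of `V` are conjugate under the orthogonal group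
`O(V) = {g ∈ GL(V) | Q(gv) = Q(v) ∀ v}`. -/
def QuadraticForm.OConj {F V : Type*} [Field F] [AddCommGroup V] [Module F V]
    (Q : QuadraticForm F V) (x y : Module.End F V) : Prop :=
  ∃ g : V ≃ₗ[F] V, (∀ v : V, Q (g v) = Q v) ∧
    y = g.toLinearMap ∘ₗ x ∘ₗ g.symm.toLinearMap

/-- The number of orbits of `O(V)` acting by conjugation on the set of nilpotent
elements of `𝔬(V)`. -/
noncomputable def QuadraticForm.numNilpotentOOrbits {F V : Type*} [Field F] [AddCommGroup V]
    [Module F V] (Q : QuadraticForm F V) : ℕ :=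
  Nat.card (Quot fun x y : {x : Module.End F V // Q.mem_oLie x ∧ IsNilpotent x} =>
    Q.OConj x.1 y.1)


/-- `(V, Q)` contains a totally singular subspace of dimension `d`
(so the Witt index of `Q` is at least `d`). -/
def QuadraticForm.HasTotallySingularSubspace {F V : Type*} [Field F] [AddCommGroup V]
    [Module F V] (Q : QuadraticForm F V) (d : ℕ) : Prop :=
  ∃ W : Submodule F V, Module.finrank F W = d ∧ ∀ w ∈ W, Q w = 0

/-- `(V₁, Q₁, T₁)` over `K` is (isomorphic to) the scalar extension of the form module
`(V₀, Q₀, T₀)` over `F ⊆ K`: there is an additive, `algebraMap`-semilinear map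
`σ : V₀ → V₁` carrying `Q₀` to `Q₁` and intertwining `T₀` with `T₁`, which carries some
`F`-basis of `V₀` to a `K`-basis of `V₁`.  (The extended quadratic form is determined by
its values and the values of its polar form on such a basis.) -/
def QuadraticForm.IsScalarExtension {F K V₀ V₁ : Type*} [Field F] [Field K] [Algebra F K]
    [AddCommGroup V₀] [Module F V₀] [AddCommGroup V₁] [Module K V₁]
    (Q₀ : QuadraticForm F V₀) (T₀ : Module.End F V₀)
    (Q₁ : QuadraticForm K V₁) (T₁ : Module.End K V₁) : Prop :=
  ∃ σ : V₀ →ₛₗ[algebraMap F K] V₁,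
    (∀ v : V₀, Q₁ (σ v) = algebraMap F K (Q₀ v)) ∧
    (∀ v : V₀, σ (T₀ v) = T₁ (σ v)) ∧
    ∃ (n : ℕ) (b : Basis (Fin n) F V₀),
      LinearIndependent K (fun i => σ (b i)) ∧
      Submodule.span K (Set.range fun i => σ (b i)) = ⊤

/-- The index function `χ(V,T) : ℕ → ℕ`,
`χ(m) = min {j ≥ 0 | Q(T^j v) = 0 for all v with T^m v = 0}`. -/
noncomputable def QuadraticForm.indexChi {F V : Type*} [Field F] [AddCommGroup V] [Module F V]
    (Q : QuadraticForm F V) (T : Module.End F V) (m : ℕ) : ℕ :=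
  sInf {j : ℕ | ∀ v : V, (T ^ m) v = 0 → Q ((T ^ j) v) = 0}

/-- `(lam i, chi i, mult i)` for `i < k` is the symbol of the form module `(V, Q, T)`:
`lam 0 > lam 1 > ⋯ > lam (k-1) ≥ 1` are the distinct Jordan block sizes of `T` (encoded by
`dim ker T^j = Σ_i (mult i) · min(j, lam i)` for all `j`), `mult i ≥ 1` are their
multiplicities, and `chi i = χ(V,T)(lam i)`. -/
def QuadraticForm.IsSymbolOf {F V : Type*} [Field F] [AddCommGroup V] [Module F V]
    (Q : QuadraticForm F V) (T : Module.End F V) (k : ℕ) (lam mult chi : ℕ → ℕ) : Prop :=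
  (∀ i : ℕ, i + 1 < k → lam (i + 1) < lam i) ∧
  (∀ i < k, 1 ≤ lam i) ∧
  (∀ i < k, 1 ≤ mult i) ∧
  (∀ j : ℕ, Module.finrank F (LinearMap.ker (T ^ j)) =
      ∑ i ∈ Finset.range k, mult i * min j (lam i)) ∧
  (∀ i < k, chi i = Q.indexChi T (lam i))

/-- `n₁ = #{1 ≤ i ≤ k-1 | χ_i + χ_{i+1} ≤ λ_i, χ_i ≠ λ_i/2}` (in 0-indexed form). -/
def symbolN1 (k : ℕ) (lam chi : ℕ → ℕ) : ℕ :=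
  ((Finset.range k).filter fun i =>
    i + 1 < k ∧ chi i + chi (i + 1) ≤ lam i ∧ 2 * chi i ≠ lam i).card

/-- `n₂ = #{1 ≤ i ≤ k | χ_i + χ_{i+1} ≤ λ_i, χ_i ≠ λ_i/2}` where `χ_{k+1} := 0`
(in 0-indexed form: `χ_k := 0`). -/
def symbolN2 (k : ℕ) (lam chi : ℕ → ℕ) : ℕ :=
  ((Finset.range k).filter fun i =>
    chi i + (if i + 1 < k then chi (i + 1) else 0) ≤ lam i ∧ 2 * chi i ≠ lam i).card


namespace OrthoNil
open QuadraticMap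
set_option linter.unusedSectionVars false

section basic
variable {K V : Type*} [Field K] [CharP K 2] [AddCommGroup V] [Module K V]

lemma add_self_zero (x : K) : x + x = 0 := CharTwo.add_self_eq_zero x

lemma eq_of_add_zero {x y : K} (h : x + y = 0) : x = y := by
  rwa [CharTwo.add_eq_zero] at h

lemma vadd_self (x : V) (K : Type*) [Field K] [CharP K 2] [Module K V] : x + x = 0 := by
  have : (1 + 1 : K) • x = 0 := by rw [add_self_zero, zero_smul]
  simpa [add_smul] using this

lemma pol_self (Q : QuadraticForm K V) (x : V) : polar Q x x = 0 := by
  rw [polar_self, two_smul]; exact add_self_zero _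

lemma qadd (Q : QuadraticForm K V) (x y : V) : Q (x + y) = Q x + Q y + polar Q x y := by
  simp [polar]

/-- `⟨T x, x⟩ = 0` for all `x`. -/
def Skew (Q : QuadraticForm K V) (T : Module.End K V) : Prop := ∀ x, polar Q (T x) x = 0

variable {Q : QuadraticForm K V} {T : Module.End K V}

lemma Skew.adj (hT : Skew Q T) (x y : V) : polar Q (T x) y = polar Q x (T y) := by
  have h := hT (x + y)
  rw [map_add, polar_add_left, polar_add_right, polar_add_right, hT x, hT y] at h
  simp only [zero_add, add_zero] at h
  rw [eq_of_add_zero h, polar_comm]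

lemma Skew.adj_pow (hT : Skew Q T) (a : ℕ) (x y : V) :
    polar Q ((T ^ a) x) y = polar Q x ((T ^ a) y) := by
  induction a generalizing x with
  | zero => simp
  | succ a ih =>
    rw [pow_succ, Module.End.mul_apply, ih, hT.adj, ← Module.End.mul_apply, ← pow_succ']
    simp [pow_succ]

lemma pow_pow_apply (a b : ℕ) (x : V) : (T ^ a) ((T ^ b) x) = (T ^ (a + b)) x := by
  rw [pow_add, Module.End.mul_apply]

lemma Skew.ppow (hT : Skew Q T) (a b : ℕ) (x y : V) :
    polar Q ((T ^ a) x) ((T ^ b) y) = polar Q ((T ^ (a + b)) x) y := by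
  rw [← hT.adj_pow, pow_pow_apply, add_comm]

lemma Skew.pself (hT : Skew Q T) (a : ℕ) (x : V) : polar Q ((T ^ a) x) x = 0 := by
  rcases Nat.even_or_odd' a with ⟨b, rfl | rfl⟩
  · rw [two_mul, ← hT.ppow, pol_self]
  · have : 2 * b + 1 = (1 + b) + b := by ring
    rw [this, ← hT.ppow, ← pow_pow_apply, pow_one, hT]

lemma Skew.pself' (hT : Skew Q T) (a b : ℕ) (x : V) :
    polar Q ((T ^ a) x) ((T ^ b) x) = 0 := by
  rw [hT.ppow, hT.pself]

lemma pow_zero_of_le {m a : ℕ} {x : V} (h : (T ^ m) x = 0) (hma : m ≤ a) : (T ^ a) x = 0 := by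
  obtain ⟨c, rfl⟩ := Nat.exists_eq_add_of_le hma
  rw [add_comm, ← pow_pow_apply, h, map_zero]

lemma polar_span_zero {S : Set V} (y : V) (h : ∀ x ∈ S, polar Q x y = 0) :
    ∀ x ∈ Submodule.span K S, polar Q x y = 0 := by
  intro x hx
  induction hx using Submodule.span_induction with
  | mem x hx => exact h x hx
  | zero => simp
  | add x z _ _ h1 h2 => rw [polar_add_left, h1, h2, add_zero]
  | smul c x _ h1 => rw [polar_smul_left, h1, smul_zero]

lemma polar_span_zero' {S S' : Set V} (h : ∀ x ∈ S, ∀ y ∈ S', polar Q x y = 0) :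
    ∀ x ∈ Submodule.span K S, ∀ y ∈ Submodule.span K S', polar Q x y = 0 := by
  intro x hx y hy
  rw [polar_comm]
  refine polar_span_zero x (fun z hz => ?_) y hy
  rw [polar_comm]
  exact polar_span_zero z (fun u hu => h u hu z hz) x hx

lemma isotropic_span {S : Set V} (h : ∀ x ∈ S, Q x = 0)
    (h2 : ∀ x ∈ S, ∀ y ∈ S, polar Q x y = 0) : ∀ x ∈ Submodule.span K S, Q x = 0 := by
  intro x hx
  induction hx using Submodule.span_induction with
  | mem x hx => exact h x hx
  | zero => simp
  | add x z hx hz h1 h3 =>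
    rw [qadd, h1, h3, polar_span_zero' h2 x hx z hz]; simp
  | smul c x _ h1 => rw [QuadraticMap.map_smul, h1, smul_zero]

/-- Descending elimination. -/
lemma elim {α : Type*} (G : α → Prop) (f : α → ℕ → K) (t : ℕ → K) (N : ℕ)
    (h : ∀ s a, G s → a < N → (∀ a', a < a' → f s a' = t a') →
      ∃ s', G s' ∧ ∀ a', a ≤ a' → f s' a' = t a')
    (s0 : α) (h0 : G s0) (h1 : ∀ a, N ≤ a → f s0 a = t a) : ∃ s, G s ∧ ∀ a, f s a = t a := by
  have key : ∀ j, j ≤ N → ∃ s, G s ∧ ∀ a, N - j ≤ a → f s a = t a := by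
    intro j
    induction j with
    | zero => intro _; exact ⟨s0, h0, h1⟩
    | succ j ih =>
      intro hj
      obtain ⟨s, hs, hs'⟩ := ih (by omega)
      exact h s (N - (j + 1)) hs (by omega) (fun a' ha' => hs' a' (by omega))
  obtain ⟨s, hs, hs'⟩ := key N le_rfl
  exact ⟨s, hs, fun a => hs' a (by omega)⟩

end basic

/-! ### Pairs -/
section pairs
variable {K V : Type*} [Field K] [CharP K 2] [AddCommGroup V] [Module K V]

/-- A hyperbolic pair of order `m`. -/
structure Pr (Q : QuadraticForm K V) (T : Module.End K V) (m : ℕ) (v w : V) : Prop where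
  pos : 1 ≤ m
  hv : (T ^ m) v = 0
  hw : (T ^ m) w = 0
  vw : ∀ a, polar Q ((T ^ a) v) w = if a + 1 = m then 1 else 0

/-- The submodule generated by a pair. -/
def Blk (T : Module.End K V) (v w : V) : Submodule K V :=
  Submodule.span K (Set.range (fun a : ℕ => (T ^ a) v) ∪ Set.range (fun a : ℕ => (T ^ a) w))

variable {Q : QuadraticForm K V} {T : Module.End K V}

lemma Blk.v_mem (v w : V) (a : ℕ) : (T ^ a) v ∈ Blk T v w :=
  Submodule.subset_span (Or.inl ⟨a, rfl⟩)

lemma Blk.w_mem (v w : V) (a : ℕ) : (T ^ a) w ∈ Blk T v w :=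
  Submodule.subset_span (Or.inr ⟨a, rfl⟩)

lemma Blk.stable {v w x : V} (hx : x ∈ Blk T v w) : T x ∈ Blk T v w := by
  unfold Blk at hx
  induction hx using Submodule.span_induction with
  | mem x hx =>
    rcases hx with ⟨a, rfl⟩ | ⟨a, rfl⟩
    · simpa [pow_succ'] using Blk.v_mem (T := T) v w (a + 1)
    · simpa [pow_succ'] using Blk.w_mem (T := T) v w (a + 1)
  | zero => simp
  | add x z hx hz h1 h3 => rw [map_add]; exact add_mem h1 h3
  | smul c x _ h1 => rw [map_smul]; exact Submodule.smul_mem _ _ h1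

lemma Blk.stable_pow {v w x : V} (hx : x ∈ Blk T v w) (a : ℕ) : (T ^ a) x ∈ Blk T v w := by
  induction a with
  | zero => simpa
  | succ a ih => rw [pow_succ', Module.End.mul_apply]; exact Blk.stable ih

lemma Blk.le {v w v' w' : V} (hv : v' ∈ Blk T v w) (hw : w' ∈ Blk T v w) :
    Blk T v' w' ≤ Blk T v w := by
  refine Submodule.span_le.2 ?_
  rintro x (⟨a, rfl⟩ | ⟨a, rfl⟩)
  · exact Blk.stable_pow hv a
  · exact Blk.stable_pow hw a

lemma Pr.swap (hT : Skew Q T) {m : ℕ} {v w : V} (h : Pr Q T m v w) : Pr Q T m w v :=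
  ⟨h.pos, h.hw, h.hv, fun a => by rw [hT.adj_pow, polar_comm, h.vw]⟩

/-- add a multiple of `T^e v` to `w`. -/
lemma Pr.addw (hT : Skew Q T) {m : ℕ} {v w : V} (h : Pr Q T m v w) (c : K) (e : ℕ) :
    Pr Q T m v (w + c • (T ^ e) v) :=
  ⟨h.pos, h.hv, by
    rw [map_add, map_smul, h.hw, pow_pow_apply, pow_zero_of_le h.hv (by omega)]; simp,
   fun a => by rw [polar_add_right, polar_smul_right, hT.pself', h.vw]; simp⟩

lemma Pr.addv (hT : Skew Q T) {m : ℕ} {v w : V} (h : Pr Q T m v w) (c : K) (e : ℕ) :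
    Pr Q T m (v + c • (T ^ e) w) w :=
  ((h.swap hT).addw hT c e).swap hT

lemma Pr.Q_addw (hT : Skew Q T) {m : ℕ} {v w : V} (h : Pr Q T m v w) (c : K) (e a : ℕ) :
    Q ((T ^ a) (w + c • (T ^ e) v)) = Q ((T ^ a) w) + c ^ 2 * Q ((T ^ (a + e)) v) +
      if 2 * a + e + 1 = m then c else 0 := by
  rw [map_add, map_smul, pow_pow_apply, qadd, QuadraticMap.map_smul,
    polar_smul_right, polar_comm, hT.ppow, h.vw]
  have : (a + e + a + 1 = m) ↔ 2 * a + e + 1 = m := by omega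
  simp only [this, smul_eq_mul, pow_two]
  split_ifs <;> simp

lemma Pr.Q_addv (hT : Skew Q T) {m : ℕ} {v w : V} (h : Pr Q T m v w) (c : K) (e a : ℕ) :
    Q ((T ^ a) (v + c • (T ^ e) w)) = Q ((T ^ a) v) + c ^ 2 * Q ((T ^ (a + e)) w) +
      if 2 * a + e + 1 = m then c else 0 := (h.swap hT).Q_addw hT c e a

/-- existence of a dual vector -/
lemma exists_pair {m : ℕ} (hm : 1 ≤ m) (hT : Skew Q T) {v y : V} (U : Submodule K V)
    (hU : ∀ x ∈ U, T x ∈ U) (hm0 : ∀ x ∈ U, (T ^ m) x = 0)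
    (hv : v ∈ U) (hy : y ∈ U) (hvy : polar Q ((T ^ (m - 1)) v) y ≠ 0) :
    ∃ w ∈ U, Pr Q T m v w := by
  have hUp : ∀ a, ∀ x ∈ U, (T ^ a) x ∈ U := by
    intro a
    induction a with
    | zero => simp
    | succ a ih => intro x hx; rw [pow_succ', Module.End.mul_apply]; exact hU _ (ih x hx)
  set c := polar Q ((T ^ (m - 1)) v) y with hc
  have hvan : ∀ x ∈ U, ∀ a, m ≤ a → polar Q ((T ^ a) v) x = 0 := by
    intro x _ a ha
    rw [pow_zero_of_le (hm0 v hv) ha, polar_zero_left]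
  obtain ⟨w, ⟨hw, hw1⟩, hw2⟩ := elim (fun w => w ∈ U ∧ polar Q ((T ^ (m - 1)) v) w = 1)
    (fun w a => polar Q ((T ^ a) v) w) (fun a => if a + 1 = m then 1 else 0) m (by
      rintro w a ⟨hw, hw1⟩ ha hi
      by_cases ham : a + 1 = m
      · refine ⟨w, ⟨hw, hw1⟩, fun a' ha' => ?_⟩
        rcases eq_or_lt_of_le ha' with h | h
        · subst h; simp only [ham, if_true]; rw [← hw1, ← ham]; simp
        · exact hi a' h
      · refine ⟨w + polar Q ((T ^ a) v) w • (T ^ (m - 1 - a)) w,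
          ⟨add_mem hw (Submodule.smul_mem _ _ (hUp _ _ hw)), ?_⟩, fun a' ha' => ?_⟩
        · rw [polar_add_right, polar_smul_right, hT.ppow, hvan w hw (m - 1 + (m - 1 - a)) (by omega), hw1]; simp
        · rcases eq_or_lt_of_le ha' with h | h
          · subst h
            have : a + (m - 1 - a) = m - 1 := by omega
            rw [polar_add_right, polar_smul_right, hT.ppow, this, hw1, if_neg ham]
            simp [add_self_zero]
          · rw [polar_add_right, polar_smul_right, hT.ppow, hvan w hw (a' + (m - 1 - a)) (by omega)]
            simpa using hi a' h) (c⁻¹ • y)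
      ⟨Submodule.smul_mem _ _ hy, by rw [polar_smul_right, ← hc]; simp [hvy]⟩ (by
        intro a ha
        rw [if_neg (by omega)]
        exact hvan _ (Submodule.smul_mem _ _ hy) _ ha)
  exact ⟨w, hw, hm, hm0 v hv, hm0 w hw, hw2⟩

end pairs
end OrthoNil

namespace OrthoNil
open QuadraticMap
set_option linter.unusedSectionVars false

section nfp
variable {K V : Type*} [Field K] [CharP K 2] [AddCommGroup V] [Module K V]

/-- A normalized pair. -/
structure NFP (Q : QuadraticForm K V) (T : Module.End K V) (m l : ℕ) (δ : K) (v w : V) : Prop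
    extends Pr Q T m v w where
  ml : m ≤ 2 * l
  lm : l ≤ m
  Qv : ∀ a, Q ((T ^ a) v) = if a + 1 = l then 1 else 0
  Qw : ∀ a, Q ((T ^ a) w) = if a + l = m then δ else 0
  d0 : 2 * l = m → δ = 0

variable {Q : QuadraticForm K V} {T : Module.End K V}

lemma normw (hp : ∀ x : K, ∃ y, y ^ 2 = x) (hT : Skew Q T) {m l : ℕ} {v w : V}
    (h : Pr Q T m v w) (ml : m ≤ 2 * l) (lm : l ≤ m)
    (Qv : ∀ a, Q ((T ^ a) v) = if a + 1 = l then 1 else 0)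
    (Qw : ∀ a, l ≤ a → Q ((T ^ a) w) = 0) :
    ∃ w' ∈ Blk T v w, ∃ δ, NFP Q T m l δ v w' := by
  obtain ⟨w', ⟨hw1, hw2, hw3⟩, hw4⟩ := elim
    (fun w' => Pr Q T m v w' ∧ w' ∈ Blk T v w ∧ ∀ a, l ≤ a → Q ((T ^ a) w') = 0)
    (fun w' a => if a + l = m then 0 else Q ((T ^ a) w')) (fun _ => 0) l (by
      rintro w' a ⟨h1, h2, h3⟩ ha hi
      by_cases ham : a + l = m
      · refine ⟨w', ⟨h1, h2, h3⟩, fun a' ha' => ?_⟩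
        rcases eq_or_lt_of_le ha' with h | h
        · subst h; simp [ham]
        · exact hi a' h
      obtain ⟨c, e, hce, hl⟩ : ∃ c e, (∀ a', a ≤ a' →
          c ^ 2 * Q ((T ^ (a' + e)) v) + (if 2 * a' + e + 1 = m then c else 0) =
            if a' = a then Q ((T ^ a) w') else 0) ∧ (m ≤ e + 2 * l) := by
        by_cases hlt : m < a + l
        · obtain ⟨c, hc⟩ := hp (Q ((T ^ a) w'))
          refine ⟨c, l - 1 - a, fun a' ha' => ?_, by omega⟩
          rw [if_neg (by omega), Qv, hc]
          by_cases h : a' = a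
          · subst h; rw [if_pos (by omega), if_pos rfl]; simp
          · rw [if_neg (by omega), if_neg h]; simp
        · refine ⟨Q ((T ^ a) w'), m - 1 - 2 * a, fun a' ha' => ?_, by omega⟩
          rw [Qv, if_neg (by omega)]
          by_cases h : a' = a
          · subst h; rw [if_pos (by omega), if_pos rfl]; simp
          · rw [if_neg (by omega), if_neg h]; simp
      have hQ : ∀ a', a ≤ a' → Q ((T ^ a') (w' + c • (T ^ e) v)) =
          Q ((T ^ a') w') + if a' = a then Q ((T ^ a) w') else 0 := by
        intro a' ha'
        rw [h1.Q_addw hT, add_assoc, hce a' ha']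
      refine ⟨w' + c • (T ^ e) v, ⟨h1.addw hT c e, add_mem h2 (Submodule.smul_mem _ _
        (Blk.v_mem _ _ _)), fun a' ha' => ?_⟩, fun a' ha' => ?_⟩
      · rw [hQ a' (by omega), h3 a' ha', if_neg (by omega), add_zero]
      · rw [hQ a' (by omega)]
        rcases eq_or_lt_of_le ha' with h | h
        · subst h; simp [add_self_zero]
        · have hne : a' ≠ a := by omega
          rw [if_neg hne, add_zero]; exact hi a' h) w
    ⟨h, by simpa using Blk.w_mem (T := T) v w 0, Qw⟩ (by
      intro a ha; rw [Qw a ha]; simp)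
  refine ⟨w', hw2, Q ((T ^ (m - l)) w'), hw1, ml, lm, Qv, fun a => ?_, fun hl => ?_⟩
  · have := hw4 a
    by_cases ham : a + l = m
    · rw [if_pos ham]; congr 3; omega
    · rwa [if_neg ham] at this ⊢
  · exact hw3 _ (by omega)

lemma Blk.pow_zero {m : ℕ} {v w : V} (h : Pr Q T m v w) : ∀ x ∈ Blk T v w, (T ^ m) x = 0 := by
  intro x hx
  have : Blk T v w ≤ LinearMap.ker (T ^ m) := by
    refine Submodule.span_le.2 ?_
    rintro x (⟨a, rfl⟩ | ⟨a, rfl⟩)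
    · simp [pow_pow_apply, pow_zero_of_le h.hv]
    · simp [pow_pow_apply, pow_zero_of_le h.hw]
  exact this hx

lemma Blk.Q_zero (hT : Skew Q T) {m l : ℕ} {v w : V} (h : Pr Q T m v w) (ml : m ≤ 2 * l)
    (Qv : ∀ a, l ≤ a → Q ((T ^ a) v) = 0) (Qw : ∀ a, l ≤ a → Q ((T ^ a) w) = 0)
    {a : ℕ} (ha : l ≤ a) : ∀ x ∈ Blk T v w, Q ((T ^ a) x) = 0 := by
  intro x hx
  refine isotropic_span (Q := Q.comp (T ^ a)) ?_ ?_ x hx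
  · rintro x (⟨b, rfl⟩ | ⟨b, rfl⟩)
    · simp only [QuadraticMap.comp_apply, pow_pow_apply]; exact Qv _ (by omega)
    · simp only [QuadraticMap.comp_apply, pow_pow_apply]; exact Qw _ (by omega)
  · have key : ∀ x y, x ∈ Blk T v w → polar (Q.comp (T ^ a)) x y = 0 := by
      intro x y hx
      have : polar (Q.comp (T ^ a)) x y = polar Q ((T ^ a) x) ((T ^ a) y) := by
        simp [polar]
      rw [this, hT.ppow, pow_zero_of_le (Blk.pow_zero h x hx) (by omega), polar_zero_left]
    intro x hx y _
    exact key x y (Submodule.subset_span hx)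

lemma normpair (hp : ∀ x : K, ∃ y, y ^ 2 = x) (hT : Skew Q T) {m l : ℕ} {v w : V}
    (h : Pr Q T m v w) (ml : m ≤ 2 * l) (lm : l ≤ m)
    (Qv : ∀ a, l ≤ a → Q ((T ^ a) v) = 0) (Qw : ∀ a, l ≤ a → Q ((T ^ a) w) = 0)
    (hne : 2 * l ≠ m → Q ((T ^ (l - 1)) v) ≠ 0) :
    ∃ v' ∈ Blk T v w, ∃ w' ∈ Blk T v w, ∃ δ, NFP Q T m l δ v' w' := by
  have hB := fun a ha => Blk.Q_zero hT h ml Qv Qw (a := a) ha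
  have hpos := h.pos
  obtain ⟨v', hv', w', hw', hpr, hQ⟩ : ∃ v' ∈ Blk T v w, ∃ w' ∈ Blk T v w, Pr Q T m v' w' ∧
      ∀ a, Q ((T ^ a) v') = if a + 1 = l then 1 else 0 := by
    by_cases hl : 2 * l = m
    · obtain ⟨v', ⟨h1, h2⟩, h3⟩ := elim
        (fun v' => Pr Q T m v' w ∧ v' ∈ Blk T v w)
        (fun v' a => Q ((T ^ a) v')) (fun a => if a + 1 = l then 1 else 0) l (by
          rintro v' a ⟨h1, h2⟩ ha hi
          refine ⟨v' + (Q ((T ^ a) v') + if a + 1 = l then 1 else 0) • (T ^ (m - 1 - 2 * a)) w,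
            ⟨h1.addv hT _ _, add_mem h2 (Submodule.smul_mem _ _ (Blk.w_mem _ _ _))⟩, ?_⟩
          intro a' ha'
          rw [h1.Q_addv hT, Qw _ (by omega)]
          rcases eq_or_lt_of_le ha' with h | h
          · subst h
            have h5 : 2 * a + (m - 1 - 2 * a) + 1 = m := by omega
            rw [if_pos h5, mul_zero, add_zero, ← add_assoc, add_self_zero, zero_add]
          · have h5 : ¬ 2 * a' + (m - 1 - 2 * a) + 1 = m := by omega
            rw [if_neg h5, mul_zero, add_zero, add_zero]; exact hi a' h) v
        ⟨h, by simpa using Blk.v_mem (T := T) v w 0⟩ (by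
          intro a ha; rw [Qv a ha, if_neg (by omega)])
      exact ⟨v', h2, w, by simpa using Blk.w_mem (T := T) v w 0, h1, h3⟩
    · have hne := hne hl
      obtain ⟨c, hc⟩ := hp (Q ((T ^ (l - 1)) v))⁻¹
      have hc0 : c ≠ 0 := by
        rintro rfl
        simp at hc
        exact hne hc.symm
      obtain ⟨v', ⟨h1, h2⟩, h3⟩ := elim
        (fun v' => v' ∈ Blk T v w ∧ polar Q ((T ^ (m - 1)) v') w ≠ 0)
        (fun v' a => Q ((T ^ a) v')) (fun a => if a + 1 = l then 1 else 0) (l - 1) (by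
          rintro v' a ⟨h1, h2⟩ ha hi
          obtain ⟨d, hd⟩ := hp (Q ((T ^ a) v'))
          refine ⟨v' + d • (T ^ (l - 1 - a)) v', ⟨add_mem h1 (Submodule.smul_mem _ _
            (Blk.stable_pow h1 _)), ?_⟩, fun a' ha' => ?_⟩
          · rw [map_add, map_smul, pow_pow_apply,
              pow_zero_of_le (a := m - 1 + (l - 1 - a)) (Blk.pow_zero h v' h1) (by omega)]
            simpa using h2
          · rw [map_add, map_smul, pow_pow_apply, qadd, polar_smul_right, hT.pself',
              QuadraticMap.map_smul, hi (a' + (l - 1 - a)) (by omega), ← pow_two, hd]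
            rcases eq_or_lt_of_le ha' with h | h
            · subst h; rw [if_pos (by omega), if_neg (by omega)]; simp [add_self_zero]
            · rw [if_neg (by omega), hi a' h]; simp) (c • v)
        ⟨Submodule.smul_mem _ _ (by simpa using Blk.v_mem (T := T) v w 0), by
          rw [map_smul, polar_smul_left, h.vw, if_pos (by omega)]; simpa using hc0⟩ (by
          intro a ha
          rw [map_smul, QuadraticMap.map_smul, ← pow_two, hc]
          by_cases hal : a + 1 = l
          · have : l - 1 = a := by omega
            rw [if_pos hal, this, smul_eq_mul, inv_mul_cancel₀]; rwa [this] at hne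
          · rw [if_neg hal, Qv a (by omega), smul_zero])
      obtain ⟨w', hw', hpr⟩ := exists_pair h.pos hT (Blk T v w) (fun x hx => Blk.stable hx)
        (Blk.pow_zero h) h1 (by simpa using Blk.w_mem (T := T) v w 0) h2
      exact ⟨v', h1, w', hw', hpr, h3⟩
  obtain ⟨w'', hw'', δ, hn⟩ := normw hp hT hpr ml lm hQ (fun a ha => hB a ha w' hw')
  exact ⟨v', hv', w'', Blk.le hv' hw' hw'', δ, hn⟩

lemma exists_nfp (hp : ∀ x : K, ∃ y, y ^ 2 = x) (hT : Skew Q T) {m : ℕ} {v w : V}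
    (h : Pr Q T m v w) :
    ∃ l, ∃ v' ∈ Blk T v w, ∃ w' ∈ Blk T v w, ∃ δ, NFP Q T m l δ v' w' := by
  classical
  have hex : ∃ l, m ≤ 2 * l ∧ ∀ a, l ≤ a → Q ((T ^ a) v) = 0 ∧ Q ((T ^ a) w) = 0 :=
    ⟨m, by omega, fun a ha => by rw [pow_zero_of_le h.hv ha, pow_zero_of_le h.hw ha]; simp⟩
  obtain ⟨hl1, hl2⟩ := Nat.find_spec hex
  have hlm : Nat.find hex ≤ m := Nat.find_min' hex
    ⟨by omega, fun a ha => by rw [pow_zero_of_le h.hv ha, pow_zero_of_le h.hw ha]; simp⟩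
  have hmin := fun j (hj : j < Nat.find hex) => Nat.find_min hex hj
  generalize Nat.find hex = l at *
  refine ⟨l, ?_⟩
  have hvm : v ∈ Blk T v w := by simpa using Blk.v_mem (T := T) v w 0
  have hwm : w ∈ Blk T v w := by simpa using Blk.w_mem (T := T) v w 0
  have hpos := h.pos
  by_cases hv : 2 * l ≠ m → Q ((T ^ (l - 1)) v) ≠ 0
  · exact normpair hp hT h hl1 hlm (fun a ha => (hl2 a ha).1) (fun a ha => (hl2 a ha).2) hv
  push Not at hv
  obtain ⟨hlm', hv0⟩ := hv
  by_cases hw0 : Q ((T ^ (l - 1)) w) = 0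
  · have hml : m = 2 * l - 1 := by
      by_contra hcon
      refine hmin (l - 1) (by omega) ⟨by omega, fun a ha => ?_⟩
      rcases eq_or_lt_of_le ha with h | h
      · subst h; exact ⟨hv0, hw0⟩
      · exact hl2 a (by omega)
    have h' := h.addv hT 1 0
    obtain ⟨v', hv', w', hw', hn⟩ := normpair hp hT h' hl1 hlm (fun a ha => by
      rw [h.Q_addv hT, (hl2 a ha).1, (hl2 (a + 0) ha).2, if_neg (by omega)]; simp)
      (fun a ha => (hl2 a ha).2) (fun _ => by
      rw [h.Q_addv hT, add_zero, hv0, hw0, if_pos (by omega)]; simp)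
    have hle : Blk T (v + (1 : K) • (T ^ 0) w) w ≤ Blk T v w := Blk.le
      (add_mem hvm (Submodule.smul_mem _ _ (Blk.w_mem _ _ _))) hwm
    exact ⟨v', hle hv', w', hle hw', hn⟩
  · obtain ⟨v', hv', w', hw', hn⟩ := normpair hp hT (h.swap hT) hl1 hlm
      (fun a ha => (hl2 a ha).2) (fun a ha => (hl2 a ha).1) (fun _ => hw0)
    exact ⟨v', Blk.le hwm hvm hv', w', Blk.le hwm hvm hw', hn⟩

end nfp
end OrthoNil

namespace OrthoNil
open QuadraticMap
set_option linter.unusedSectionVars false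

section rel
variable {K V : Type*} [Field K] [CharP K 2] [AddCommGroup V] [Module K V]

/-- Mutual orthogonality of the blocks. -/
def Cross (Q : QuadraticForm K V) (T : Module.End K V) {P : Type*} (v w : P → V) : Prop :=
  ∀ p q, p ≠ q → ∀ x ∈ Blk T (v p) (w p), ∀ y ∈ Blk T (v q) (w q), polar Q x y = 0

variable {Q : QuadraticForm K V} {T : Module.End K V}

lemma Cross.of_gens (hT : Skew Q T) {P : Type*} {v w : P → V}
    (h : ∀ p q, p ≠ q → ∀ a, polar Q ((T ^ a) (v p)) (v q) = 0 ∧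
      polar Q ((T ^ a) (v p)) (w q) = 0 ∧ polar Q ((T ^ a) (w p)) (w q) = 0) :
    Cross Q T v w := by
  intro p q hpq
  refine polar_span_zero' ?_
  rintro x (⟨a, rfl⟩ | ⟨a, rfl⟩) y (⟨b, rfl⟩ | ⟨b, rfl⟩)
  · simp only [hT.ppow]; exact (h p q hpq _).1
  · simp only [hT.ppow]; exact (h p q hpq _).2.1
  · simp only [hT.ppow]; rw [hT.adj_pow, polar_comm]; exact (h q p hpq.symm _).2.1
  · simp only [hT.ppow]; exact (h p q hpq _).2.2

lemma Pr.proj (hT : Skew Q T) {m : ℕ} {v w : V} (h : Pr Q T m v w) (x : V) :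
    ∃ b ∈ Blk T v w, ∀ y ∈ Blk T v w, polar Q y (x + b) = 0 := by
  have key : ∀ {v w : V}, Pr Q T m v w → ∃ b ∈ Submodule.span K (Set.range fun a : ℕ => (T ^ a) w),
      ∀ c, polar Q ((T ^ c) v) (x + b) = 0 := by
    intro v w h
    refine ⟨∑ a ∈ Finset.range m, polar Q ((T ^ (m - 1 - a)) v) x • (T ^ a) w,
      Submodule.sum_mem _ fun a _ => Submodule.smul_mem _ _ (Submodule.subset_span ⟨a, rfl⟩), ?_⟩
    intro c
    by_cases hc : c < m
    · rw [polar_add_right, ← polarBilin_apply_apply, ← polarBilin_apply_apply, map_sum,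
        Finset.sum_eq_single (m - 1 - c)]
      · have h1 : m - 1 - (m - 1 - c) = c := by omega
        have h2 : c + (m - 1 - c) + 1 = m := by omega
        simp only [map_smul, polarBilin_apply_apply, hT.ppow, h.vw, h1, h2]
        simp [add_self_zero]
      · intro a ha hac
        rw [Finset.mem_range] at ha
        have h2 : ¬ (c + a + 1 = m) := by omega
        simp only [map_smul, polarBilin_apply_apply, hT.ppow, h.vw, h2]
        simp
      · intro hn; exact absurd (Finset.mem_range.2 (by omega)) hn
    · rw [pow_zero_of_le h.hv (by omega), polar_zero_left]
  obtain ⟨b1, hb1, h1⟩ := key h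
  obtain ⟨b2, hb2, h2⟩ := key (h.swap hT)
  have hz : ∀ {u b : V}, b ∈ Submodule.span K (Set.range fun a : ℕ => (T ^ a) u) →
      ∀ c, polar Q ((T ^ c) u) b = 0 := by
    intro u b hb c
    rw [polar_comm]
    refine polar_span_zero _ ?_ b hb
    rintro _ ⟨a, rfl⟩
    exact hT.pself' _ _ _
  refine ⟨b1 + b2, add_mem (Submodule.span_mono Set.subset_union_right hb1)
    (Submodule.span_mono Set.subset_union_left hb2), ?_⟩
  refine polar_span_zero _ ?_
  rintro _ (⟨a, rfl⟩ | ⟨a, rfl⟩)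
  · rw [← add_assoc, polar_add_right, h1, hz hb2, add_zero]
  · rw [add_comm b1, ← add_assoc, polar_add_right, h2, hz hb1, add_zero]

lemma exists_rel_aux [FiniteDimensional K V] (hT : Skew Q T) (hnil : IsNilpotent T) (n : ℕ) :
    ∀ U : Submodule K V, Module.finrank K U ≤ n → (∀ x ∈ U, T x ∈ U) →
      (∀ x ∈ U, (∀ y ∈ U, polar Q x y = 0) → x = 0) →
      ∃ (P : Type) (_ : Fintype P) (_ : DecidableEq P) (m : P → ℕ) (v w : P → V),
        (∀ p, Pr Q T (m p) (v p) (w p)) ∧ Cross Q T v w ∧ (∀ p, Blk T (v p) (w p) ≤ U) ∧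
        U ≤ ⨆ p, Blk T (v p) (w p) := by
  classical
  induction n with
  | zero =>
    intro U hU _ _
    have : U = ⊥ := by
      rw [← Submodule.finrank_eq_zero (R := K)]; omega
    exact ⟨Empty, inferInstance, inferInstance, Empty.elim, Empty.elim, Empty.elim,
      fun p => p.elim, fun p => p.elim, fun p => p.elim, by simp [this]⟩
  | succ n ih =>
    intro U hU hst hnd
    by_cases hbot : U = ⊥
    · exact ⟨Empty, inferInstance, inferInstance, Empty.elim, Empty.elim, Empty.elim,
        fun p => p.elim, fun p => p.elim, fun p => p.elim, by simp [hbot]⟩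
    have hUp : ∀ a, ∀ x ∈ U, (T ^ a) x ∈ U := by
      intro a
      induction a with
      | zero => simp
      | succ a ih => intro x hx; rw [pow_succ', Module.End.mul_apply]; exact hst _ (ih x hx)
    have hex : ∃ m, ∀ x ∈ U, (T ^ m) x = 0 := by
      obtain ⟨m, hm⟩ := hnil
      exact ⟨m, fun x _ => by rw [hm]; simp⟩
    have hm0 := Nat.find_spec hex
    have hmin := fun j (hj : j < Nat.find hex) => Nat.find_min hex hj
    generalize Nat.find hex = m at *
    have hm1 : 1 ≤ m := by
      by_contra hcon
      have : m = 0 := by omega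
      subst this
      exact hbot ((Submodule.eq_bot_iff _).2 fun x hx => by simpa using hm0 x hx)
    have h1 := hmin (m - 1) (by omega)
    push Not at h1
    obtain ⟨v, hv, hv0⟩ := h1
    have h2 : ∃ y ∈ U, polar Q ((T ^ (m - 1)) v) y ≠ 0 := by
      by_contra hcon
      push Not at hcon
      exact hv0 (hnd _ (hUp _ _ hv) hcon)
    obtain ⟨y, hy, hvy⟩ := h2
    obtain ⟨w, hw, hpr⟩ := exists_pair hm1 hT U hst hm0 hv hy hvy
    have hBU : Blk T v w ≤ U := by
      refine Submodule.span_le.2 ?_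
      rintro x (⟨a, rfl⟩ | ⟨a, rfl⟩)
      · exact hUp _ _ hv
      · exact hUp _ _ hw
    let U' : Submodule K V :=
      { carrier := {x | x ∈ U ∧ ∀ y ∈ Blk T v w, polar Q y x = 0}
        add_mem' := fun {x y} hx hy => ⟨add_mem hx.1 hy.1, fun z hz => by
          rw [polar_add_right, hx.2 z hz, hy.2 z hz, add_zero]⟩
        zero_mem' := ⟨zero_mem _, fun z _ => polar_zero_right _ _⟩
        smul_mem' := fun c x hx => ⟨Submodule.smul_mem _ _ hx.1, fun z hz => by
          rw [polar_smul_right, hx.2 z hz, smul_zero]⟩ }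
    have hle : U' ≤ U := fun x hx => hx.1
    have hdec : ∀ x ∈ U, ∃ b ∈ Blk T v w, x + b ∈ U' := by
      intro x hx
      obtain ⟨b, hb, hb'⟩ := hpr.proj hT x
      exact ⟨b, hb, add_mem hx (hBU hb), hb'⟩
    have hlt : U' < U := by
      refine lt_of_le_of_ne hle fun heq => ?_
      have : w ∈ U' := by rw [heq]; exact hw
      have h3 := this.2 _ (Blk.v_mem v w (m - 1))
      rw [hpr.vw, if_pos (by omega)] at h3
      exact one_ne_zero h3
    obtain ⟨P, iF, iD, m', v', w', hPr, hC, hB, hs⟩ := ih U' (by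
        have := Submodule.finrank_lt_finrank_of_lt hlt; omega)
      (fun x hx => ⟨hst x hx.1, fun y hy => by
        rw [← hT.adj]; exact hx.2 _ (Blk.stable hy)⟩)
      (fun x hx h => hnd x hx.1 fun y hy => by
        obtain ⟨b, hb, hb'⟩ := hdec y hy
        have h4 := h _ hb'
        rw [polar_add_right, polar_comm Q x b, hx.2 b hb, add_zero] at h4
        exact h4)
    refine ⟨Option P, inferInstance, inferInstance, fun o => o.elim m m', fun o => o.elim v v',
      fun o => o.elim w w', ?_, ?_, ?_, ?_⟩
    · rintro (_ | p)
      · exact hpr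
      · exact hPr p
    · rintro (_ | p) (_ | q) hpq x hx y hy
      · exact absurd rfl hpq
      · exact (hB q hy).2 x hx
      · rw [polar_comm]; exact (hB p hx).2 y hy
      · exact hC p q (fun h => hpq (by rw [h])) x hx y hy
    · rintro (_ | p)
      · exact hBU
      · exact (hB p).trans hle
    · intro x hx
      obtain ⟨b, hb, hb'⟩ := hdec x hx
      have h5 : x = (x + b) + b := by rw [add_assoc, vadd_self b K, add_zero]
      rw [h5]
      refine add_mem ?_ ?_
      · refine (iSup_le fun p => ?_ : (⨆ p, Blk T (v' p) (w' p)) ≤ _) (hs hb')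
        exact le_iSup (fun o : Option P => Blk T (o.elim v v') (o.elim w w')) (some p)
      · exact (le_iSup (fun o : Option P => Blk T (o.elim v v') (o.elim w w')) none) hb

/-! ### The basis attached to a frame -/

variable {P : Type*} [Fintype P] [DecidableEq P]

/-- index type of the basis -/
abbrev Idx (m : P → ℕ) := Σ p : P, Fin (m p) × Bool

/-- basis vectors -/
def ev (T : Module.End K V) {m : P → ℕ} (v w : P → V) (i : Idx m) : V :=
  (T ^ (i.2.1 : ℕ)) (if i.2.2 then w i.1 else v i.1)

/-- dual index -/
def Idx.dual {m : P → ℕ} (i : Idx m) : Idx m := ⟨i.1, i.2.1.rev, !i.2.2⟩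

lemma polar_z (hT : Skew Q T) {m : P → ℕ} {v w : P → V}
    (hP : ∀ p, Pr Q T (m p) (v p) (w p)) (hC : Cross Q T v w) (p q : P) (s t : Bool) (a : ℕ) :
    polar Q ((T ^ a) (if s then w p else v p)) (if t then w q else v q) =
      if p = q ∧ s ≠ t ∧ a + 1 = m p then 1 else 0 := by
  by_cases hpq : p = q
  · subst hpq
    cases s <;> cases t
    · simp [hT.pself]
    · simp [(hP p).vw]
    · simp [((hP p).swap hT).vw]
    · simp [hT.pself]
  · rw [if_neg (c := p = q ∧ s ≠ t ∧ a + 1 = m p) (fun h => hpq h.1)]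
    refine hC p q hpq _ ?_ _ ?_
    · cases s
      · exact Blk.v_mem _ _ _
      · exact Blk.w_mem _ _ _
    · cases t
      · simpa using Blk.v_mem (T := T) (v q) (w q) 0
      · simpa using Blk.w_mem (T := T) (v q) (w q) 0

lemma polar_ev (hT : Skew Q T) {m : P → ℕ} {v w : P → V}
    (hP : ∀ p, Pr Q T (m p) (v p) (w p)) (hC : Cross Q T v w) (i j : Idx m) :
    polar Q (ev T v w i) (ev T v w j) =
      if i.1 = j.1 ∧ i.2.2 ≠ j.2.2 ∧ (i.2.1 : ℕ) + j.2.1 + 1 = m i.1 then 1 else 0 := by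
  unfold ev
  rw [hT.ppow, polar_z hT hP hC]

lemma polar_ev_dual (hT : Skew Q T) {m : P → ℕ} {v w : P → V}
    (hP : ∀ p, Pr Q T (m p) (v p) (w p)) (hC : Cross Q T v w) (i j : Idx m) :
    polar Q (ev T v w i) (ev T v w j.dual) = if i = j then 1 else 0 := by
  rw [polar_ev hT hP hC]
  congr 1
  obtain ⟨p, a, s⟩ := i
  obtain ⟨q, b, t⟩ := j
  simp only [Idx.dual, eq_iff_iff, Sigma.mk.injEq]
  constructor
  · rintro ⟨rfl, h2, h3⟩
    refine ⟨rfl, heq_of_eq ?_⟩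
    have : s = t := by cases s <;> cases t <;> simp_all
    subst this
    have hb := b.2
    simp only [Fin.val_rev] at h3
    congr 1
    apply Fin.ext
    omega
  · rintro ⟨rfl, h⟩
    obtain ⟨rfl, rfl⟩ := Prod.mk.inj (eq_of_heq h)
    refine ⟨rfl, by cases s <;> simp, ?_⟩
    have ha := a.2
    simp only [Fin.val_rev]
    omega

lemma ev_li (hT : Skew Q T) {m : P → ℕ} {v w : P → V}
    (hP : ∀ p, Pr Q T (m p) (v p) (w p)) (hC : Cross Q T v w) :
    LinearIndependent K (ev T v w (m := m)) := by
  refine LinearIndependent.of_pairwise_dual_eq_zero_one _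
    (fun j => (polarBilin Q).flip (ev T v w j.dual)) ?_ ?_
  · intro i j hij
    simp only [LinearMap.flip_apply, polarBilin_apply_apply]
    rw [polar_ev_dual hT hP hC, if_neg (by first | exact hij | exact hij.symm)]
  · intro i
    simp only [LinearMap.flip_apply, polarBilin_apply_apply]
    rw [polar_ev_dual hT hP hC, if_pos rfl]

lemma card_idx (m : P → ℕ) : Fintype.card (Idx m) = ∑ p, 2 * m p := by
  simp [Idx, mul_comm]

lemma blk_le_ev {m : P → ℕ} {v w : P → V}
    (hP : ∀ p, Pr Q T (m p) (v p) (w p)) (p : P) :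
    Blk T (v p) (w p) ≤ Submodule.span K (Set.range (ev T v w (m := m))) := by
  refine Submodule.span_le.2 ?_
  rintro x (⟨a, rfl⟩ | ⟨a, rfl⟩)
  · by_cases ha : a < m p
    · exact Submodule.subset_span ⟨⟨p, ⟨a, ha⟩, false⟩, by simp [ev]⟩
    · simp [pow_zero_of_le (hP p).hv (not_lt.1 ha)]
  · by_cases ha : a < m p
    · exact Submodule.subset_span ⟨⟨p, ⟨a, ha⟩, true⟩, by simp [ev]⟩
    · simp [pow_zero_of_le (hP p).hw (not_lt.1 ha)]

end rel

section rel2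
variable {K V : Type*} [Field K] [CharP K 2] [AddCommGroup V] [Module K V]
variable {Q : QuadraticForm K V} {T : Module.End K V}

lemma exists_rel [FiniteDimensional K V] (hT : Skew Q T) (hnil : IsNilpotent T)
    (hnd : ∀ x, (∀ y, polar Q x y = 0) → x = 0) :
      ∃ (P : Type) (_ : Fintype P) (_ : DecidableEq P) (m : P → ℕ) (v w : P → V),
        (∀ p, Pr Q T (m p) (v p) (w p)) ∧ Cross Q T v w ∧
        Module.finrank K V = ∑ p, 2 * m p := by
  obtain ⟨P, iF, iD, m, v, w, hPr, hC, hB, hs⟩ := exists_rel_aux hT hnil _ (⊤ : Submodule K V)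
    le_rfl (by simp) (fun x _ h => hnd x fun y => h y trivial)
  refine ⟨P, iF, iD, m, v, w, hPr, hC, ?_⟩
  have hs' : ⊤ ≤ Submodule.span K (Set.range (ev T v w (m := m))) :=
    hs.trans (iSup_le fun p => blk_le_ev hPr p)
  rw [Module.finrank_eq_card_basis (Module.Basis.mk (ev_li hT hPr hC) hs'), card_idx]

/-- A frame for `(V,Q,T)`. -/
structure Frm (Q : QuadraticForm K V) (T : Module.End K V) {P : Type} [Fintype P]
    (m l : P → ℕ) (δ : P → K) (v w : P → V) : Prop where
  nf : ∀ p, NFP Q T (m p) (l p) (δ p) (v p) (w p)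
  cr : Cross Q T v w
  dim : Module.finrank K V = ∑ p, 2 * m p

lemma Cross.mono {P : Type*} {v w v' w' : P → V} (h : Cross Q T v w)
    (hv : ∀ p, v' p ∈ Blk T (v p) (w p)) (hw : ∀ p, w' p ∈ Blk T (v p) (w p)) :
    Cross Q T v' w' :=
  fun p q hpq x hx y hy => h p q hpq x (Blk.le (hv p) (hw p) hx) y (Blk.le (hv q) (hw q) hy)

lemma exists_frm [FiniteDimensional K V] (hp : ∀ x : K, ∃ y, y ^ 2 = x)
    (hT : Skew Q T) (hnil : IsNilpotent T)
    (hnd : ∀ x, (∀ y, polar Q x y = 0) → x = 0) :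
      ∃ (P : Type) (_ : Fintype P) (_ : DecidableEq P) (m l : P → ℕ) (δ : P → K) (v w : P → V),
        Frm Q T m l δ v w := by
  obtain ⟨P, iF, iD, m, v, w, hPr, hC, hd⟩ := exists_rel hT hnil hnd
  choose l v' hv' w' hw' δ hn using fun p => exists_nfp hp hT (hPr p)
  exact ⟨P, iF, iD, m, l, δ, v', w', hn, hC.mono hv' hw', hd⟩

end rel2
end OrthoNil

namespace OrthoNil
open QuadraticMap
set_option linter.unusedSectionVars false

section mem'
variable {K V : Type*} [Field K] [CharP K 2] [AddCommGroup V] [Module K V] {T : Module.End K V}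
lemma Blk.v_mem' (v w : V) : v ∈ Blk T v w := by simpa using Blk.v_mem (T := T) v w 0
lemma Blk.w_mem' (v w : V) : w ∈ Blk T v w := by simpa using Blk.w_mem (T := T) v w 0
end mem'

section basis
variable {K V : Type*} [Field K] [CharP K 2] [AddCommGroup V] [Module K V] [FiniteDimensional K V]
variable {Q : QuadraticForm K V} {T : Module.End K V}
variable {P : Type} [Fintype P] [DecidableEq P] {m l : P → ℕ} {δ : P → K} {v w : P → V}

lemma Frm.pr (h : Frm Q T m l δ v w) (p : P) : Pr Q T (m p) (v p) (w p) := (h.nf p).toPr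

/-- the basis attached to a frame -/
noncomputable def Frm.basis (hT : Skew Q T) (h : Frm Q T m l δ v w) : Basis (Idx m) K V :=
  Basis.mk (ev_li hT h.pr h.cr) (le_of_eq
    ((ev_li hT h.pr h.cr).span_eq_top_of_card_eq_finrank' (by rw [card_idx, h.dim])).symm)

lemma Frm.basis_apply (hT : Skew Q T) (h : Frm Q T m l δ v w) (i : Idx m) :
    h.basis hT i = ev T v w i := by simp [Frm.basis]

lemma Frm.repr (hT : Skew Q T) (h : Frm Q T m l δ v w) (x : V) (i : Idx m) :
    (h.basis hT).repr x i = polar Q x (ev T v w i.dual) := by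
  have key : (h.basis hT).coord i = (polarBilin Q).flip (ev T v w i.dual) := by
    refine (h.basis hT).ext fun j => ?_
    rw [Basis.coord_apply, Basis.repr_self, LinearMap.flip_apply, polarBilin_apply_apply,
      h.basis_apply, polar_ev_dual hT h.pr h.cr, Finsupp.single_apply]
  have := LinearMap.congr_fun key x
  simpa using this

lemma Frm.induct (hT : Skew Q T) (h : Frm Q T m l δ v w) {C : V → Prop} (x : V)
    (h0 : C 0) (ha : ∀ x y, C x → C y → C (x + y)) (hs : ∀ (c : K) x, C x → C (c • x))
    (hv : ∀ p a, C ((T ^ a) (v p))) (hw : ∀ p a, C ((T ^ a) (w p))) : C x := by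
  have hx : x ∈ Submodule.span K (Set.range (h.basis hT)) := by
    rw [(h.basis hT).span_eq]; trivial
  induction hx using Submodule.span_induction with
  | mem x hx =>
    obtain ⟨⟨p, a, s⟩, rfl⟩ := hx
    rw [h.basis_apply]
    cases s
    · exact hv p a
    · exact hw p a
  | zero => exact h0
  | add x z _ _ h1 h2 => exact ha _ _ h1 h2
  | smul c x _ h1 => exact hs c x h1

end basis

section iso
variable {F K V V' : Type*} [Field F] [Field K] [CharP F 2] [CharP K 2]
  [AddCommGroup V] [Module F V] [FiniteDimensional F V]
  [AddCommGroup V'] [Module K V'] [FiniteDimensional K V']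
variable {Q : QuadraticForm F V} {T : Module.End F V}
variable {Q' : QuadraticForm K V'} {T' : Module.End K V'}
variable {P : Type} [Fintype P] [DecidableEq P] {m l : P → ℕ} {δ : P → F} {v w : P → V}

lemma semi_polar {f : F →+* K} {σ : V →ₛₗ[f] V'} (hσ : ∀ x, Q' (σ x) = f (Q x)) (x y : V) :
    polar Q' (σ x) (σ y) = f (polar Q x y) := by
  simp only [polar, ← map_add, ← map_sub, hσ]

lemma semi_pow {f : F →+* K} {σ : V →ₛₗ[f] V'} (hσ : ∀ x, σ (T x) = T' (σ x)) (a : ℕ) (x : V) :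
    (T' ^ a) (σ x) = σ ((T ^ a) x) := by
  induction a with
  | zero => simp
  | succ a ih => rw [pow_succ', Module.End.mul_apply, ih, pow_succ', Module.End.mul_apply, hσ]

lemma Frm.push {f : F →+* K} (σ : V →ₛₗ[f] V') (hσ : ∀ x, Q' (σ x) = f (Q x))
    (hσT : ∀ x, σ (T x) = T' (σ x)) (hT' : Skew Q' T')
    (hd : Module.finrank K V' = Module.finrank F V)
    (h : Frm Q T m l δ v w) :
    Frm Q' T' m l (fun p => f (δ p)) (fun p => σ (v p)) (fun p => σ (w p)) := by
  refine ⟨fun p => ?_, ?_, by rw [hd, h.dim]⟩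
  · have hn := h.nf p
    refine ⟨⟨hn.pos, ?_, ?_, ?_⟩, hn.ml, hn.lm, ?_, ?_, ?_⟩
    · rw [semi_pow hσT, hn.hv, map_zero]
    · rw [semi_pow hσT, hn.hw, map_zero]
    · intro a
      rw [semi_pow hσT, semi_polar hσ, hn.vw]; split_ifs <;> simp
    · intro a
      rw [semi_pow hσT, hσ, hn.Qv]; split_ifs <;> simp
    · intro a
      rw [semi_pow hσT, hσ, hn.Qw]; split_ifs <;> simp
    · intro h2; rw [hn.d0 h2, map_zero]
  · refine Cross.of_gens hT' fun p q hpq a => ?_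
    have := h.cr p q hpq
    refine ⟨?_, ?_, ?_⟩
    · rw [semi_pow hσT, semi_polar hσ, this _ (Blk.v_mem _ _ _) _ (Blk.v_mem' _ _), map_zero]
    · rw [semi_pow hσT, semi_polar hσ, this _ (Blk.v_mem _ _ _) _ (Blk.w_mem' _ _), map_zero]
    · rw [semi_pow hσT, semi_polar hσ, this _ (Blk.w_mem _ _ _) _ (Blk.w_mem' _ _), map_zero]

lemma Q_ev {m l : P → ℕ} {δ : P → F} {v w : P → V} (h : Frm Q T m l δ v w) (i : Idx m) :
    Q (ev T v w i) = if i.2.2 then (if (i.2.1 : ℕ) + l i.1 = m i.1 then δ i.1 else 0)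
      else (if (i.2.1 : ℕ) + 1 = l i.1 then 1 else 0) := by
  obtain ⟨p, a, s⟩ := i
  cases s
  · simp [ev, (h.nf p).Qv]
  · simp [ev, (h.nf p).Qw]

lemma Frm.iso (f : F →+* K) (hT : Skew Q T) (hT' : Skew Q' T')
    (h : Frm Q T m l δ v w) {v' w' : P → V'} (h' : Frm Q' T' m l (fun p => f (δ p)) v' w') :
    ∃ σ : V →ₛₗ[f] V', (∀ x, Q' (σ x) = f (Q x)) ∧ (∀ x, σ (T x) = T' (σ x)) ∧
      ∀ i : Idx m, σ (ev T v w i) = ev T' v' w' i := by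
  let b := h.basis hT
  let σ : V →ₛₗ[f] V' :=
    { toFun := fun x => ∑ i, f (b.repr x i) • ev T' v' w' i
      map_add' := fun x y => by simp [add_smul, Finset.sum_add_distrib]
      map_smul' := fun c x => by simp [mul_smul, Finset.smul_sum] }
  have hb : ∀ i : Idx m, σ (ev T v w i) = ev T' v' w' i := by
    intro i
    change ∑ j, f (b.repr (ev T v w i) j) • ev T' v' w' j = _
    rw [← h.basis_apply hT, Basis.repr_self, Finset.sum_eq_single i]
    · simp
    · intro j _ hj; simp [Finsupp.single_apply, hj.symm]
    · simp
  have hspan : ∀ x, x ∈ Submodule.span F (Set.range (ev T v w (m := m))) := by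
    intro x
    have : x ∈ Submodule.span F (Set.range b) := by rw [b.span_eq]; trivial
    have e : (b : Idx m → V) = ev T v w := funext fun i => h.basis_apply hT i
    rwa [e] at this
  have hpol : ∀ x y, polar Q' (σ x) (σ y) = f (polar Q x y) := by
    intro x y
    have hx := hspan x
    induction hx using Submodule.span_induction with
    | zero => simp
    | add x z _ _ h1 h2 => rw [map_add, polar_add_left, h1, h2, polar_add_left, map_add]
    | smul c x _ h1 => rw [map_smulₛₗ, polar_smul_left, h1, polar_smul_left]; simp
    | mem x hx =>
      obtain ⟨i, rfl⟩ := hx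
      have hy := hspan y
      induction hy using Submodule.span_induction with
      | zero => simp
      | add x z _ _ h1 h2 => rw [map_add, polar_add_right, h1, h2, polar_add_right, map_add]
      | smul c x _ h1 => rw [map_smulₛₗ, polar_smul_right, h1, polar_smul_right]; simp
      | mem y hy =>
        obtain ⟨j, rfl⟩ := hy
        rw [hb, hb, polar_ev hT h.pr h.cr, polar_ev hT' h'.pr h'.cr]
        split_ifs <;> simp
  have hpv : ∀ p a, σ ((T ^ a) (v p)) = (T' ^ a) (v' p) := by
    intro p a
    by_cases ha : a < m p
    · simpa [ev] using hb ⟨p, ⟨a, ha⟩, false⟩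
    · rw [pow_zero_of_le (h.nf p).hv (not_lt.1 ha), pow_zero_of_le (h'.nf p).hv (not_lt.1 ha),
        map_zero]
  have hpw : ∀ p a, σ ((T ^ a) (w p)) = (T' ^ a) (w' p) := by
    intro p a
    by_cases ha : a < m p
    · simpa [ev] using hb ⟨p, ⟨a, ha⟩, true⟩
    · rw [pow_zero_of_le (h.nf p).hw (not_lt.1 ha), pow_zero_of_le (h'.nf p).hw (not_lt.1 ha),
        map_zero]
  refine ⟨σ, fun x => ?_, fun x => ?_, hb⟩
  · have hx := hspan x
    induction hx using Submodule.span_induction with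
    | zero => simp
    | add x z _ _ h1 h2 => rw [map_add, qadd, h1, h2, qadd, hpol, map_add, map_add]
    | smul c x _ h1 => rw [map_smulₛₗ, QuadraticMap.map_smul, h1, QuadraticMap.map_smul]; simp
    | mem x hx =>
      obtain ⟨i, rfl⟩ := hx
      rw [hb, Q_ev h, Q_ev h']
      split_ifs <;> simp
  · refine h.induct hT (C := fun x => σ (T x) = T' (σ x)) x (by simp) (fun x y h1 h2 => by simp [h1, h2])
      (fun c x h1 => by simp [map_smulₛₗ, h1]) (fun p a => ?_) (fun p a => ?_)
    · rw [hpv, ← Module.End.mul_apply, ← pow_succ', hpv, ← Module.End.mul_apply, ← pow_succ']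
    · rw [hpw, ← Module.End.mul_apply, ← pow_succ', hpw, ← Module.End.mul_apply, ← pow_succ']

lemma Frm.isoExt [Algebra F K] (hT : Skew Q T) (hT' : Skew Q' T')
    (h : Frm Q T m l δ v w) {v' w' : P → V'}
    (h' : Frm Q' T' m l (fun p => algebraMap F K (δ p)) v' w') :
    QuadraticForm.IsScalarExtension Q T Q' T' := by
  obtain ⟨σ, h1, h2, h3⟩ := h.iso (algebraMap F K) hT hT' h'
  let e := Fintype.equivFin (Idx m)
  refine ⟨σ, h1, h2, _, (h.basis hT).reindex e, ?_⟩
  have : (fun i => σ ((h.basis hT).reindex e i)) = ((h'.basis hT').reindex e) := by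
    funext i
    simp [h.basis_apply, h'.basis_apply, h3]
  rw [this]
  exact ⟨Basis.linearIndependent _, Basis.span_eq _⟩

lemma finrank_ext [Algebra F K] (h : QuadraticForm.IsScalarExtension Q T Q' T') :
    Module.finrank K V' = Module.finrank F V := by
  obtain ⟨σ, h1, h2, n, b, h3, h4⟩ := h
  rw [Module.finrank_eq_card_basis b, Module.finrank_eq_card_basis (Basis.mk h3 h4.ge)]

end iso

section iso2
variable {K V V' : Type*} [Field K] [CharP K 2]
  [AddCommGroup V] [Module K V] [FiniteDimensional K V]
  [AddCommGroup V'] [Module K V'] [FiniteDimensional K V']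
variable {Q : QuadraticForm K V} {T : Module.End K V}
variable {Q' : QuadraticForm K V'} {T' : Module.End K V'}
variable {P : Type} [Fintype P] [DecidableEq P] {m l : P → ℕ} {δ : P → K} {v w : P → V}

lemma Frm.isom (hT : Skew Q T) (hT' : Skew Q' T')
    (h : Frm Q T m l δ v w) {v' w' : P → V'} (h' : Frm Q' T' m l δ v' w') :
    ∃ g : V ≃ₗ[K] V', (∀ x, Q' (g x) = Q x) ∧ (∀ x, g (T x) = T' (g x)) := by
  obtain ⟨σ, h1, h2, h3⟩ := h.iso (RingHom.id K) hT hT' h'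
  let g := (h.basis hT).equiv (h'.basis hT') (Equiv.refl _)
  have hg : g.toLinearMap = σ := by
    refine (h.basis hT).ext fun i => ?_
    rw [LinearEquiv.coe_coe, Basis.equiv_apply, Equiv.refl_apply, h.basis_apply, h'.basis_apply, h3]
  have hg' : ∀ x, g x = σ x := fun x => by rw [← hg]; rfl
  refine ⟨g, fun x => by rw [hg', h1]; rfl, fun x => by rw [hg', hg', h2]⟩

lemma Frm.conj {T' : Module.End K V} (hT : Skew Q T) (hT' : Skew Q T')
    (h : Frm Q T m l δ v w) {v' w' : P → V} (h' : Frm Q T' m l δ v' w') :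
    Q.OConj T T' := by
  obtain ⟨g, h1, h2⟩ := h.isom hT hT' h'
  refine ⟨g, h1, ?_⟩
  ext x
  simp [h2]

end iso2
end OrthoNil

namespace OrthoNil
open QuadraticMap
set_option linter.unusedSectionVars false

section moves
variable {K V : Type*} [Field K] [CharP K 2] [AddCommGroup V] [Module K V] [FiniteDimensional K V]
variable {Q : QuadraticForm K V} {T : Module.End K V}
variable {P : Type} [Fintype P] [DecidableEq P] {m l : P → ℕ} {δ : P → K} {v w : P → V}

lemma Frm.vv (hT : Skew Q T) (h : Frm Q T m l δ v w) (r s : P) (a : ℕ) :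
    polar Q ((T ^ a) (v r)) (v s) = 0 := by
  simpa using polar_z hT h.pr h.cr r s false false a

lemma Frm.ww (hT : Skew Q T) (h : Frm Q T m l δ v w) (r s : P) (a : ℕ) :
    polar Q ((T ^ a) (w r)) (w s) = 0 := by
  simpa using polar_z hT h.pr h.cr r s true true a

lemma Frm.vw (hT : Skew Q T) (h : Frm Q T m l δ v w) (r s : P) (a : ℕ) :
    polar Q ((T ^ a) (v r)) (w s) = if r = s ∧ a + 1 = m r then 1 else 0 := by
  simpa using polar_z hT h.pr h.cr r s false true a

lemma Frm.wv (hT : Skew Q T) (h : Frm Q T m l δ v w) (r s : P) (a : ℕ) :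
    polar Q ((T ^ a) (w r)) (v s) = if r = s ∧ a + 1 = m r then 1 else 0 := by
  simpa using polar_z hT h.pr h.cr r s true false a

lemma NFP.shift (hT : Skew Q T) {m l : ℕ} {δ : K} {v w : V} (h : NFP Q T m l δ v w)
    (hl : m < 2 * l) (c : K) : NFP Q T m l (δ + c ^ 2 + c) v (w + c • (T ^ (2 * l - m - 1)) v) := by
  have hlm := h.lm
  refine ⟨h.toPr.addw hT c _, h.ml, h.lm, h.Qv, fun a => ?_, fun h2 => by omega⟩
  rw [h.toPr.Q_addw hT, h.Qw, h.Qv]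
  have e1 : (a + (2 * l - m - 1) + 1 = l) ↔ a + l = m := by omega
  have e2 : (2 * a + (2 * l - m - 1) + 1 = m) ↔ a + l = m := by omega
  simp only [e1, e2]
  split_ifs <;> simp

lemma Frm.shift (hT : Skew Q T) (h : Frm Q T m l δ v w) (δ' : P → K)
    (h0 : ∀ p, 2 * l p = m p → δ' p = 0) (hd : ∀ p, ∃ c, δ' p = δ p + c ^ 2 + c) :
    ∃ w', Frm Q T m l δ' v w' := by
  have key : ∀ p, ∃ w' ∈ Blk T (v p) (w p), NFP Q T (m p) (l p) (δ' p) (v p) w' := by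
    intro p
    by_cases h2 : 2 * l p = m p
    · refine ⟨w p, Blk.w_mem' _ _, ?_⟩
      have := h.nf p
      rw [this.d0 h2] at this
      rwa [h0 p h2]
    · obtain ⟨c, hc⟩ := hd p
      rw [hc]
      exact ⟨_, add_mem (Blk.w_mem' _ _) (Submodule.smul_mem _ _ (Blk.v_mem _ _ _)),
        (h.nf p).shift hT (by have := (h.nf p).ml; omega) c⟩
  choose w' hw' hn using key
  exact ⟨w', hn, h.cr.mono (fun p => Blk.v_mem' _ _) hw', h.dim⟩

lemma Frm.move (hT : Skew Q T) (h : Frm Q T m l δ v w) {p q : P} (hpq : p ≠ q)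
    (h1 : m p < l p + l q) (h2 : m q < l p + l q) (hp : m p < 2 * l p) (hq : m q < 2 * l q)
    (c : K) : ∃ w', Frm Q T m l (fun r => if r = p ∨ r = q then δ r + c ^ 2 else δ r) v w' := by
  let e : P → ℕ := fun r => l p + l q - 1 - m r
  let t := Equiv.swap p q
  let d : P → K := fun r => if r = p ∨ r = q then c else 0
  have tp : t p = q := Equiv.swap_apply_left _ _
  have tq : t q = p := Equiv.swap_apply_right _ _
  have dp : d p = c := by simp [d]
  have dq : d q = c := by simp [d]
  have htr : ∀ r, d r ≠ 0 → r = p ∨ r = q := by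
    intro r hr
    by_contra hcon
    exact hr (by simp only [d, hcon, if_false])
  refine ⟨fun r => w r + d r • (T ^ e r) (v (t r)), fun r => ?_, ?_, h.dim⟩
  · have hn := h.nf r
    have hw' : d r • (T ^ (m r + e r)) (v (t r)) = 0 := by
      by_cases hr : d r = 0
      · rw [hr, zero_smul]
      rcases htr r hr with rfl | rfl
      · rw [tp, pow_zero_of_le (h.nf q).hv (by simp only [e]; omega), smul_zero]
      · rw [tq, pow_zero_of_le (h.nf p).hv (by simp only [e]; omega), smul_zero]
    refine ⟨⟨hn.pos, hn.hv, ?_, fun a => ?_⟩, hn.ml, hn.lm, hn.Qv, fun a => ?_, fun h3 => ?_⟩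
    · rw [map_add, map_smul, hn.hw, pow_pow_apply, hw', zero_add]
    · rw [polar_add_right, polar_smul_right, hT.ppow, h.vv hT, hn.vw]; simp
    · rw [map_add, map_smul, pow_pow_apply, qadd, QuadraticMap.map_smul, polar_smul_right, hT.ppow,
        h.wv hT, hn.Qw, (h.nf (t r)).Qv]
      by_cases hr : r = p ∨ r = q
      · have hdr : d r = c := by simp only [d, hr, if_true]
        have htr : r ≠ t r := by
          rcases hr with rfl | rfl
          · rw [tp]; exact hpq
          · rw [tq]; exact hpq.symm
        have hle := hn.lm
        have e1 : (a + e r + 1 = l (t r)) ↔ a + l r = m r := by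
          rcases hr with rfl | rfl
          · rw [tp]; simp only [e]; omega
          · rw [tq]; simp only [e]; omega
        simp only [hdr, hr, if_true, htr, false_and, if_false, e1]
        split_ifs <;> simp [pow_two]
      · have hdr : d r = 0 := by simp only [d, hr, if_false]
        simp only [hdr, hr, if_false]
        simp
    · have hr : ¬ (r = p ∨ r = q) := by
        rintro (rfl | rfl) <;> omega
      simp only [hr, if_false]
      exact hn.d0 h3
  · refine Cross.of_gens hT fun r s hrs a => ⟨h.vv hT _ _ _, ?_, ?_⟩
    · rw [polar_add_right, polar_smul_right, hT.ppow, h.vv hT, h.vw hT]; simp [hrs]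
    · simp only [polar_add_right, polar_smul_right, map_add, map_smul, polar_add_left,
        polar_smul_left, pow_pow_apply, hT.ppow, h.vv hT, h.vw hT, h.wv hT, h.ww hT]
      simp only [smul_zero, add_zero, zero_add]
      by_cases hr : t r = s
      · have hr2 : r = t s := by rw [← hr]; simp [t]
        by_cases hr3 : r = p ∨ r = q
        · rcases hr3 with rfl | rfl
          · rw [tp] at hr; subst hr
            have : (a + e r + 1 = m q) ↔ (a + e q + 1 = m r) := by simp only [e]; omega
            simp only [tp, tq, dp, dq, this, true_and]
            exact add_self_zero _
          · rw [tq] at hr; subst hr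
            have : (a + e p + 1 = m r) ↔ (a + e r + 1 = m p) := by simp only [e]; omega
            simp only [tp, tq, dp, dq, this, true_and]
            exact add_self_zero _
        · exfalso
          push Not at hr3
          have : t r = r := Equiv.swap_apply_of_ne_of_ne hr3.1 hr3.2
          exact hrs (this.symm.trans hr)
      · have hr2 : ¬ r = t s := by rintro rfl; exact hr (by simp [t])
        simp [hr, hr2]

lemma Frm.raise (hp : ∀ x : K, ∃ y, y ^ 2 = x) (hT : Skew Q T) (h : Frm Q T m l δ v w) {p q : P}
    (hlt : l p < l q - (m q - m p)) :
    ∃ δ' v' w', Frm Q T m (fun r => if r = p then l q - (m q - m p) else l r) δ' v' w' := by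
  have hpq : p ≠ q := by rintro rfl; omega
  have hqp := hpq.symm
  let v1 : P → V := fun r => if r = p then v p + (T ^ (m q - m p)) (v q) else v r
  let w1 : P → V := fun r => if r = q then w q + (T ^ (m p - m q)) (w p) else w r
  have v1p : v1 p = v p + (T ^ (m q - m p)) (v q) := by simp [v1]
  have w1q : w1 q = w q + (T ^ (m p - m q)) (w p) := by simp [w1]
  have v1n : ∀ {r}, r ≠ p → v1 r = v r := fun hr => by simp [v1, hr]
  have w1n : ∀ {r}, r ≠ q → w1 r = w r := fun hr => by simp [w1, hr]
  have np := h.nf p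
  have nq := h.nf q
  have b1 := np.ml
  have b2 := np.lm
  have b3 := nq.ml
  have b4 := nq.lm
  have b5 := np.pos
  have b6 := nq.pos
  have hcr : Cross Q T v1 w1 := by
    refine Cross.of_gens hT fun r s hrs a => ⟨?_, ?_, ?_⟩
    · by_cases hr : r = p <;> by_cases hs : s = p
      · subst hr; subst hs; exact absurd rfl hrs
      · subst hr; rw [v1p, v1n hs, map_add, polar_add_left, pow_pow_apply, h.vv hT, h.vv hT,
          add_zero]
      · subst hs; rw [v1p, v1n hr, polar_add_right, hT.ppow, h.vv hT, h.vv hT, add_zero]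
      · rw [v1n hr, v1n hs, h.vv hT]
    · by_cases hr : r = p <;> by_cases hs : s = q
      · subst hr; subst hs
        rw [v1p, w1q]
        simp only [polar_add_right, map_add, polar_add_left, pow_pow_apply, hT.ppow, h.vw hT]
        simp only [hpq, hqp, false_and, if_false, true_and, add_zero, zero_add]
        have : (a + (m s - m r) + 1 = m s) ↔ (a + (m r - m s) + 1 = m r) := by omega
        simp only [this]
        exact add_self_zero _
      · subst hr
        rw [v1p, w1n hs, map_add, polar_add_left, pow_pow_apply, h.vw hT, h.vw hT]
        simp [hrs, Ne.symm hs]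
      · subst hs
        rw [v1n hr, w1q, polar_add_right, hT.ppow, h.vw hT, h.vw hT]
        simp [hrs, hr]
      · rw [v1n hr, w1n hs, h.vw hT]; simp [hrs]
    · by_cases hr : r = q <;> by_cases hs : s = q
      · subst hr; subst hs; exact absurd rfl hrs
      · subst hr; rw [w1q, w1n hs, map_add, polar_add_left, pow_pow_apply, h.ww hT, h.ww hT,
          add_zero]
      · subst hs; rw [w1q, w1n hr, polar_add_right, hT.ppow, h.ww hT, h.ww hT, add_zero]
      · rw [w1n hr, w1n hs, h.ww hT]
  have key : ∀ r, ∃ v' ∈ Blk T (v1 r) (w1 r), ∃ w' ∈ Blk T (v1 r) (w1 r), ∃ δ',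
      NFP Q T (m r) (if r = p then l q - (m q - m p) else l r) δ' v' w' := by
    intro r
    by_cases hr : r = p
    · subst hr
      rw [if_pos rfl, v1p, w1n hpq]
      refine normpair hp hT ⟨np.pos, ?_, np.hw, fun a => ?_⟩ (by omega) (by omega)
        (fun a ha => ?_) (fun a ha => ?_) (fun _ => ?_)
      · rw [map_add, np.hv, pow_pow_apply, pow_zero_of_le nq.hv (by omega), add_zero]
      · rw [map_add, polar_add_left, pow_pow_apply, np.vw, h.vw hT]; simp [hqp]
      · rw [map_add, qadd, pow_pow_apply, hT.ppow, h.vv hT, np.Qv, nq.Qv]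
        have c1 : ¬ (a + 1 = l r) := by omega
        have c2 : ¬ (a + (m q - m r) + 1 = l q) := by omega
        simp [c1, c2]
      · rw [np.Qw]
        have c1 : ¬ (a + l r = m r) := by omega
        simp [c1]
      · rw [map_add, qadd, pow_pow_apply, hT.ppow, h.vv hT, np.Qv, nq.Qv]
        have c1 : ¬ (l q - (m q - m r) - 1 + 1 = l r) := by omega
        have c2 : (l q - (m q - m r) - 1 + (m q - m r) + 1 = l q) := by omega
        simp [c1, c2]
    · rw [if_neg hr, v1n hr]
      by_cases hs : r = q
      · subst hs
        rw [w1q]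
        refine normpair hp hT ⟨nq.pos, nq.hv, ?_, fun a => ?_⟩ nq.ml nq.lm
          (fun a ha => ?_) (fun a ha => ?_) (fun _ => ?_)
        · rw [map_add, nq.hw, pow_pow_apply, pow_zero_of_le np.hw (by omega), add_zero]
        · rw [polar_add_right, hT.ppow, nq.vw, h.vw hT]; simp [hqp]
        · have c1 : ¬ (a + 1 = l r) := by omega
          rw [nq.Qv, if_neg c1]
        · rw [map_add, qadd, pow_pow_apply, hT.ppow, h.ww hT, np.Qw, nq.Qw]
          have c2 : ¬ (a + (m p - m r) + l p = m p) := by omega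
          simp only [c2, if_false, add_zero]
          split_ifs with c1
          · exact nq.d0 (by omega)
          · rfl
        · have c1 : l r - 1 + 1 = l r := by omega
          rw [nq.Qv, if_pos c1]; exact one_ne_zero
      · rw [w1n hs]
        exact ⟨_, Blk.v_mem' _ _, _, Blk.w_mem' _ _, _, h.nf r⟩
  choose v' hv' w' hw' δ' hn using key
  exact ⟨δ', v', w', hn, hcr.mono hv' hw', h.dim⟩

/-- Saturation -/
def Sat (m l : P → ℕ) : Prop := ∀ p q, l q ≤ l p + (m q - m p)

lemma Frm.saturate (hp : ∀ x : K, ∃ y, y ^ 2 = x) (hT : Skew Q T) (N : ℕ) :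
    ∀ (l : P → ℕ) (δ : P → K) (v w : P → V), Frm Q T m l δ v w → ∑ p, m p ≤ ∑ p, l p + N →
    ∃ (l : P → ℕ) (δ : P → K) (v w : P → V), Frm Q T m l δ v w ∧ Sat m l := by
  induction N with
  | zero =>
    intro l δ v w h hN
    refine ⟨l, δ, v, w, h, ?_⟩
    have : ∀ p, l p = m p := by
      intro p
      have h1 : ∑ p, l p = ∑ p, m p := le_antisymm
        (Finset.sum_le_sum fun p _ => (h.nf p).lm) (by omega)
      exact (Finset.sum_eq_sum_iff_of_le (fun p _ => (h.nf p).lm)).1 h1 p (Finset.mem_univ p)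
    intro p q
    rw [this, this]; omega
  | succ N ih =>
    intro l δ v w h hN
    by_cases hs : Sat m l
    · exact ⟨l, δ, v, w, h, hs⟩
    unfold Sat at hs
    push Not at hs
    obtain ⟨p, q, hpq⟩ := hs
    obtain ⟨δ', v', w', h'⟩ := h.raise hp hT (p := p) (q := q) (by omega)
    refine ih _ δ' v' w' h' ?_
    have : ∑ p, l p < ∑ r, (if r = p then l q - (m q - m p) else l r) := by
      refine Finset.sum_lt_sum (fun r _ => ?_) ⟨p, Finset.mem_univ p, ?_⟩
      · split_ifs with hr
        · subst hr; omega
        · exact le_rfl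
      · rw [if_pos rfl]; omega
    omega

lemma exists_sat (hp : ∀ x : K, ∃ y, y ^ 2 = x) (hT : Skew Q T) (hnil : IsNilpotent T)
    (hnd : ∀ x, (∀ y, polar Q x y = 0) → x = 0) :
      ∃ (P : Type) (_ : Fintype P) (_ : DecidableEq P) (m l : P → ℕ) (δ : P → K) (v w : P → V),
        Frm Q T m l δ v w ∧ Sat m l := by
  obtain ⟨P, iF, iD, m, l, δ, v, w, h⟩ := exists_frm hp hT hnil hnd
  exact ⟨P, iF, iD, m, Frm.saturate hp hT (∑ p, m p) l δ v w h (by omega)⟩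

end moves
end OrthoNil

namespace OrthoNil
open QuadraticMap
set_option linter.unusedSectionVars false

lemma min_second (j x : ℕ) :
    2 * min (j + 1) x = min j x + min (j + 2) x + if x = j + 1 then 1 else 0 := by
  split_ifs <;> omega

lemma sum_second {ι : Type*} (s : Finset ι) (c x : ι → ℕ) (j : ℕ) :
    2 * ∑ i ∈ s, c i * min (j + 1) (x i) = ∑ i ∈ s, c i * min j (x i) +
      ∑ i ∈ s, c i * min (j + 2) (x i) + ∑ i ∈ s, c i * (if x i = j + 1 then 1 else 0) := by
  rw [Finset.mul_sum, ← Finset.sum_add_distrib, ← Finset.sum_add_distrib]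
  refine Finset.sum_congr rfl fun i _ => ?_
  rw [← mul_add, ← mul_add, ← min_second]; ring

lemma sum_match {ι κ : Type*} (s : Finset ι) (t : Finset κ) (c x : ι → ℕ) (d y : κ → ℕ)
    (h : ∀ j, ∑ i ∈ s, c i * min j (x i) = ∑ i ∈ t, d i * min j (y i)) (j : ℕ) :
    ∑ i ∈ s, c i * (if x i = j + 1 then 1 else 0) =
      ∑ i ∈ t, d i * (if y i = j + 1 then 1 else 0) := by
  have h1 := sum_second s c x j
  have h2 := sum_second t d y j
  have a1 := h j
  have a2 := h (j + 1)
  have a3 := h (j + 2)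
  omega

lemma card_min (m j : ℕ) : ∑ a : Fin m, (if m ≤ (a : ℕ) + j then 1 else 0) = min j m := by
  rw [Fin.sum_univ_eq_sum_range (fun a => if m ≤ a + j then 1 else 0) m, ← Finset.card_filter]
  have : (Finset.range m).filter (fun a => m ≤ a + j) = Finset.Ico (m - j) m := by
    ext a; simp; omega
  rw [this, Nat.card_Ico]; omega

section ker
variable {K V : Type*} [Field K] [CharP K 2] [AddCommGroup V] [Module K V] [FiniteDimensional K V]
variable {Q : QuadraticForm K V} {T : Module.End K V}
variable {P : Type} [Fintype P] [DecidableEq P] {m l : P → ℕ} {δ : P → K} {v w : P → V}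

lemma Frm.ker_eq (hT : Skew Q T) (h : Frm Q T m l δ v w) (j : ℕ) :
    LinearMap.ker (T ^ j) = Submodule.span K (Set.range
      (fun i : {i : Idx m // m i.1 ≤ (i.2.1 : ℕ) + j} => ev T v w i.1)) := by
  refine le_antisymm (fun x hx => ?_) (Submodule.span_le.2 ?_)
  · rw [LinearMap.mem_ker] at hx
    rw [← (h.basis hT).sum_repr x]
    refine Submodule.sum_mem _ fun i _ => ?_
    by_cases hi : m i.1 ≤ (i.2.1 : ℕ) + j
    · refine Submodule.smul_mem _ _ (Submodule.subset_span ⟨⟨i, hi⟩, ?_⟩)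
      rw [h.basis_apply]
    · have : (h.basis hT).repr x i = 0 := by
        rw [h.repr]
        obtain ⟨p, a, s⟩ := i
        simp only at hi
        have e : ev T v w (Idx.dual ⟨p, a, s⟩ : Idx m) =
            (T ^ j) ((T ^ (m p - 1 - a - j)) (if !s then w p else v p)) := by
          rw [pow_pow_apply]
          simp only [ev, Idx.dual, Fin.val_rev]
          have : m p - (a + 1) = j + (m p - 1 - a - j) := by omega
          rw [this]
          cases s <;> rfl
        rw [e, ← hT.adj_pow, hx, polar_zero_left]
      rw [this, zero_smul]; exact zero_mem _
  · rintro _ ⟨⟨⟨p, a, s⟩, hi⟩, rfl⟩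
    simp only at hi
    rw [SetLike.mem_coe, LinearMap.mem_ker]
    cases s
    · simp only [ev, pow_pow_apply]; exact pow_zero_of_le (h.nf p).hv (by omega)
    · simp only [ev, pow_pow_apply]; exact pow_zero_of_le (h.nf p).hw (by omega)

lemma Frm.ker_dim (hT : Skew Q T) (h : Frm Q T m l δ v w) (j : ℕ) :
    Module.finrank K (LinearMap.ker (T ^ j)) = ∑ p, 2 * min j (m p) := by
  have hli : LinearIndependent K (fun i : {i : Idx m // m i.1 ≤ (i.2.1 : ℕ) + j} => ev T v w i.1) :=
    (ev_li hT h.pr h.cr).comp _ Subtype.val_injective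
  rw [h.ker_eq hT, finrank_span_eq_card hli, Fintype.card_subtype, Finset.card_filter,
    Fintype.sum_sigma]
  refine Finset.sum_congr rfl fun p _ => ?_
  rw [Fintype.sum_prod_type, ← card_min, Finset.mul_sum]
  refine Finset.sum_congr rfl fun a _ => ?_
  split_ifs <;> simp

lemma Frm.chi (hT : Skew Q T) (h : Frm Q T m l δ v w) (hs : Sat m l) (p : P) :
    Q.indexChi T (m p) = l p := by
  unfold QuadraticForm.indexChi
  have np := h.nf p
  have b1 := np.ml
  have b2 := np.lm
  have b3 := np.pos
  refine IsLeast.csInf_eq ⟨fun x hx => ?_, fun j hj => ?_⟩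
  · have hx' : x ∈ LinearMap.ker (T ^ m p) := hx
    rw [h.ker_eq hT] at hx'
    refine isotropic_span (Q := Q.comp (T ^ l p)) ?_ ?_ x hx'
    · rintro _ ⟨⟨⟨q, a, s⟩, hi⟩, rfl⟩
      simp only at hi
      have nq := h.nf q
      have c1 := nq.ml
      have c2 := hs p q
      cases s
      · have : ¬ (l p + a + 1 = l q) := by omega
        simp [ev, pow_pow_apply, nq.Qv, this]
      · simp only [ev, QuadraticMap.comp_apply, pow_pow_apply]
        simp only [if_true, nq.Qw]
        split_ifs with c3
        · exact nq.d0 (by omega)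
        · rfl
    · rintro _ ⟨⟨⟨q, a, s⟩, hi⟩, rfl⟩ _ ⟨⟨⟨r, b, t⟩, hj⟩, rfl⟩
      simp only at hi hj
      have : ∀ x y, polar (Q.comp (T ^ l p)) x y = polar Q ((T ^ l p) x) ((T ^ l p) y) := by
        intro x y; simp [polar]
      rw [this]
      simp only [ev, pow_pow_apply, hT.ppow]
      rw [polar_z hT h.pr h.cr]
      exact if_neg (fun h3 => by obtain ⟨rfl, h4, h5⟩ := h3; omega)
  · by_contra hcon
    have h1 := hj ((T ^ (l p - 1 - j)) (v p)) (by
      rw [pow_pow_apply]; exact pow_zero_of_le np.hv (by omega))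
    have c1 : j + (l p - 1 - j) + 1 = l p := by omega
    rw [pow_pow_apply, np.Qv, if_pos c1] at h1
    exact one_ne_zero h1

lemma Frm.card_match (hT : Skew Q T) (h : Frm Q T m l δ v w)
    {P' : Type} [Fintype P'] [DecidableEq P'] {m' l' : P' → ℕ} {δ' : P' → K} {v' w' : P' → V}
    (h' : Frm Q T m' l' δ' v' w') (hs : Sat m l) (hs' : Sat m' l') :
    ∃ e : P ≃ P', (∀ p, m' (e p) = m p) ∧ (∀ p, l' (e p) = l p) := by
  have hc : ∀ j, Nonempty ({p // m p = j} ≃ {p // m' p = j}) := by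
    intro j
    refine ⟨Fintype.equivOfCardEq ?_⟩
    rcases j with _ | j
    · have e1 : IsEmpty {p // m p = 0} := ⟨fun p => by have := (h.nf p.1).pos; omega⟩
      have e2 : IsEmpty {p // m' p = 0} := ⟨fun p => by have := (h'.nf p.1).pos; omega⟩
      simp
    · have := sum_match Finset.univ Finset.univ (fun _ : P => 2) m (fun _ : P' => 2) m'
        (fun j => by rw [← h.ker_dim hT, ← h'.ker_dim hT]) j
      rw [← Finset.mul_sum, ← Finset.mul_sum, ← Finset.card_filter, ← Finset.card_filter] at this
      rw [Fintype.card_subtype, Fintype.card_subtype]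
      omega
  let e := Equiv.ofFiberEquiv (fun j => Classical.choice (hc j))
  have he : ∀ p, m' (e p) = m p := fun p => Equiv.ofFiberEquiv_map _ p
  refine ⟨e, he, fun p => ?_⟩
  rw [← h'.chi hT hs', he, h.chi hT hs]

lemma Frm.reindex {P' : Type} [Fintype P'] {m' l' : P' → ℕ} {δ' : P' → K} {v' w' : P' → V}
    (h' : Frm Q T m' l' δ' v' w') (e : P ≃ P') :
    Frm Q T (m' ∘ e) (l' ∘ e) (δ' ∘ e) (v' ∘ e) (w' ∘ e) :=
  ⟨fun p => h'.nf (e p), fun p q hpq => h'.cr (e p) (e q) (fun h => hpq (e.injective h)), by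
    rw [h'.dim]; exact (Equiv.sum_comp e (fun p => 2 * m' p)).symm⟩

end ker

section desc
variable {F K V V' : Type*} [Field F] [Field K] [CharP F 2] [CharP K 2] [Algebra F K]
  [AddCommGroup V] [Module F V] [FiniteDimensional F V]
  [AddCommGroup V'] [Module K V'] [FiniteDimensional K V']
variable {Q : QuadraticForm F V} {T : Module.End F V}
variable {Q' : QuadraticForm K V'} {T' : Module.End K V'}
variable {P : Type} [Fintype P] [DecidableEq P] {m l : P → ℕ} {δ' : P → K} {v' w' : P → V'}

lemma exists_desc (hp : ∀ x : F, ∃ y, y ^ 2 = x) (hT : Skew Q T) (hnil : IsNilpotent T)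
    (hnd : ∀ x, (∀ y, polar Q x y = 0) → x = 0) (hT' : Skew Q' T')
    (h' : Frm Q' T' m l δ' v' w') (hs : Sat m l) (hx : QuadraticForm.IsScalarExtension Q T Q' T') :
    ∃ (δ : P → F) (v w : P → V), Frm Q T m l δ v w := by
  obtain ⟨P1, iF, iD, m1, l1, δ1, v1, w1, h1, hs1⟩ := exists_sat hp hT hnil hnd
  have hd := finrank_ext hx
  obtain ⟨σ, h2, h3, -⟩ := hx
  obtain ⟨e, he1, he2⟩ := h'.card_match hT' (h1.push σ h2 h3 hT' hd) hs hs1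
  have := h1.reindex e
  rw [show m1 ∘ e = m from funext he1, show l1 ∘ e = l from funext he2] at this
  exact ⟨_, _, _, this⟩

end desc
end OrthoNil

namespace OrthoNil
open QuadraticMap
set_option linter.unusedSectionVars false

/-- combinatorial data relating a frame to a symbol -/
structure Cmb {P : Type} (m l : P → ℕ) (k : ℕ) (lam chi : ℕ → ℕ) (c : P → ℕ) (s : ℕ → P) :
    Prop where
  ck : ∀ p, c p < k
  mc : ∀ p, m p = lam (c p)
  lc : ∀ p, l p = chi (c p)
  cs : ∀ i < k, c (s i) = i
  lt : ∀ i j, i < j → j < k → lam j < lam i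
  pos : ∀ i < k, 1 ≤ lam i
  ml : ∀ i < k, lam i ≤ 2 * chi i
  lm : ∀ i < k, chi i ≤ lam i
  mono : ∀ i j, i < j → j < k → chi j ≤ chi i
  sub : ∀ i j, i < j → j < k → lam j + chi i ≤ lam i + chi j

/-- the index set -/
def BB (k : ℕ) (lam chi : ℕ → ℕ) : Finset ℕ :=
  (Finset.range k).filter fun i =>
    chi i + (if i + 1 < k then chi (i + 1) else 0) ≤ lam i ∧ 2 * chi i ≠ lam i

section cmb
variable {K V : Type*} [Field K] [CharP K 2] [AddCommGroup V] [Module K V] [FiniteDimensional K V]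
variable {Q : QuadraticForm K V} {T : Module.End K V}
variable {P : Type} [Fintype P] [DecidableEq P] {m l : P → ℕ} {δ : P → K} {v w : P → V}
variable {k : ℕ} {lam mult chi : ℕ → ℕ}

lemma Frm.cmb [Nonempty P] (hT : Skew Q T) (h : Frm Q T m l δ v w) (hs : Sat m l)
    (hsy : Q.IsSymbolOf T k lam mult chi) : ∃ c s, Cmb m l k lam chi c s := by
  obtain ⟨h1, h2, h3, h4, h5⟩ := hsy
  have hlt : ∀ i j, i < j → j < k → lam j < lam i := by
    intro i j hij
    induction j, hij using Nat.le_induction with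
    | base => exact h1 i
    | succ j hij ih => intro hj; exact (h1 j hj).trans (ih (by omega))
  have hm := fun j => sum_match Finset.univ (Finset.range k) (fun _ : P => 2) m mult lam
    (fun j => by rw [← h.ker_dim hT, h4]) j
  have hc : ∀ p, ∃ i, i < k ∧ lam i = m p := by
    intro p
    by_contra hcon
    push Not at hcon
    have hpos := (h.nf p).pos
    have := hm (m p - 1)
    have e : m p - 1 + 1 = m p := by omega
    rw [e, Finset.sum_eq_zero (s := Finset.range k)] at this
    · have := (Finset.sum_eq_zero_iff.1 this) p (Finset.mem_univ p)
      simp at this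
    · intro i hi
      rw [if_neg (hcon i (Finset.mem_range.1 hi)), mul_zero]
  have hs' : ∀ i, ∃ p, i < k → m p = lam i := by
    intro i
    by_cases hi : i < k
    · by_contra hcon
      push Not at hcon
      have hpos := h2 i hi
      have := hm (lam i - 1)
      have e : lam i - 1 + 1 = lam i := by omega
      rw [e, Finset.sum_eq_zero (s := Finset.univ)] at this
      · have := (Finset.sum_eq_zero_iff.1 this.symm) i (Finset.mem_range.2 hi)
        have := h3 i hi
        simp at *
        omega
      · intro p _
        rw [if_neg (hcon p).2, mul_zero]
    · exact ⟨Classical.arbitrary P, fun h => absurd h hi⟩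
  choose c hck hcm using hc
  choose s hs' using hs'
  have hinj : ∀ i j, i < k → j < k → lam i = lam j → i = j := by
    intro i j hi hj he
    rcases lt_trichotomy i j with h | h | h
    · have := hlt i j h hj; omega
    · exact h
    · have := hlt j i h hi; omega
  have hl : ∀ i < k, l (s i) = chi i := fun i hi => by
    rw [h5 i hi, ← hs' i hi, h.chi hT hs]
  refine ⟨c, s, hck, fun p => (hcm p).symm, fun p => ?_, fun i hi => ?_, hlt, h2, fun i hi => ?_,
    fun i hi => ?_, fun i j hij hj => ?_, fun i j hij hj => ?_⟩
  · rw [h5 _ (hck p), hcm, h.chi hT hs]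
  · exact hinj _ _ (hck _) hi (by rw [hcm, hs' i hi])
  · rw [← hl i hi, ← hs' i hi]; exact (h.nf _).ml
  · rw [← hl i hi, ← hs' i hi]; exact (h.nf _).lm
  · have := hs (s i) (s j)
    have h6 := hlt i j hij hj
    rw [hl i (by omega), hl j hj, hs' i (by omega), hs' j hj] at this
    omega
  · have := hs (s j) (s i)
    have h6 := hlt i j hij hj
    rw [hl i (by omega), hl j hj, hs' i (by omega), hs' j hj] at this
    omega

variable {c : P → ℕ} {s : ℕ → P}

lemma Frm.reduce1 (hp : ∀ x : K, ∃ y, y ^ 2 = x) (hT : Skew Q T) (hC : Cmb m l k lam chi c s)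
    (N : ℕ) : ∀ (δ : P → K) (w : P → V), Frm Q T m l δ v w →
      (∑ p, open Classical in
        if δ p = 0 then 0 else 2 * (k - c p) + (if p = s (c p) then 0 else 1)) < N →
    ∃ (δ : P → K) (w : P → V), Frm Q T m l δ v w ∧
      ∀ p, δ p ≠ 0 → p = s (c p) ∧ c p ∈ BB k lam chi := by
  classical
  induction N with
  | zero => intro δ w _ h; omega
  | succ N ih =>
    intro δ w h hN
    by_cases hfin : ∀ p, δ p ≠ 0 → p = s (c p) ∧ c p ∈ BB k lam chi
    · exact ⟨δ, w, h, hfin⟩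
    push Not at hfin
    obtain ⟨p, hp0, hpn⟩ := hfin
    have np := h.nf p
    have hlp : m p < 2 * l p := by
      have h1 := np.ml
      have h2 : 2 * l p ≠ m p := fun h2 => hp0 (np.d0 h2)
      omega
    have hcp := hC.ck p
    have hmp := hC.mc p
    have hlp' := hC.lc p
    obtain ⟨q, hpq, h1, h2, h3, h4⟩ : ∃ q, p ≠ q ∧ m p < l p + l q ∧ m q < l p + l q ∧
        m q < 2 * l q ∧ 2 * (k - c q) + (if q = s (c q) then 0 else 1) <
          2 * (k - c p) + (if p = s (c p) then 0 else 1) := by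
      by_cases hps : p = s (c p)
      · have hB := hpn hps
        simp only [BB, Finset.mem_filter, Finset.mem_range, not_and_or] at hB
        have hB2 : ¬ (chi (c p) + (if c p + 1 < k then chi (c p + 1) else 0) ≤ lam (c p)) := by
          rcases hB with hB | hB | hB
          · exact absurd hcp hB
          · exact hB
          · exact absurd (show 2 * chi (c p) ≠ lam (c p) by omega) hB
        have hlm := hC.lm _ hcp
        have hk : c p + 1 < k := by
          by_contra hk
          rw [if_neg hk] at hB2
          omega
        rw [if_pos hk] at hB2
        have e1 := hC.cs _ hk
        have e2 := hC.mc (s (c p + 1))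
        have e3 := hC.lc (s (c p + 1))
        rw [e1] at e2 e3
        have e4 := hC.lt (c p) (c p + 1) (by omega) hk
        have e5 := hC.sub (c p) (c p + 1) (by omega) hk
        refine ⟨s (c p + 1), ?_, by omega, by omega, by omega, ?_⟩
        · intro he
          rw [← he] at e1
          omega
        · rw [e1, if_pos rfl, ← hps, if_pos rfl]
          omega
      · have e1 := hC.cs _ hcp
        have e2 := hC.mc (s (c p))
        have e3 := hC.lc (s (c p))
        rw [e1] at e2 e3
        refine ⟨s (c p), hps, by omega, by omega, by omega, ?_⟩
        rw [e1, if_pos rfl, if_neg hps]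
        omega
    obtain ⟨y, hy⟩ := hp (δ p)
    obtain ⟨w', hw'⟩ := h.move hT hpq h1 h2 hlp h3 y
    refine ih _ w' hw' ?_
    refine lt_of_lt_of_le ?_ (Nat.lt_succ_iff.1 hN)
    have hq : q ∈ Finset.univ.erase p := by simp [hpq.symm]
    rw [← Finset.add_sum_erase _ _ (Finset.mem_univ p), ← Finset.add_sum_erase _ _ hq,
      ← Finset.add_sum_erase (a := p) Finset.univ _ (Finset.mem_univ p),
      ← Finset.add_sum_erase (a := q) (Finset.univ.erase p) _ hq, ← add_assoc, ← add_assoc]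
    refine add_lt_add_of_lt_of_le ?_ (le_of_eq (Finset.sum_congr rfl fun r hr => ?_))
    · have e : δ p + y ^ 2 = 0 := by rw [hy]; exact add_self_zero _
      simp only [true_or, or_true, if_true, e, hp0, if_false]
      split_ifs at h4 ⊢ <;> omega
    · simp only [Finset.mem_erase] at hr
      simp only [hr.1, hr.2.1, or_false, if_false]

/-- canonical values -/
noncomputable def dcan (δ0 : K) (c : P → ℕ) (s : ℕ → P) (d : Finset ℕ) (p : P) : K :=
  if p = s (c p) ∧ c p ∈ d then δ0 else 0

lemma Frm.reduce (hp : ∀ x : K, ∃ y, y ^ 2 = x) (δ0 : K)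
    (h0 : ∀ x : K, (∃ y, x = y ^ 2 + y) ∨ (∃ y, x + δ0 = y ^ 2 + y))
    (hT : Skew Q T) (hC : Cmb m l k lam chi c s) (h : Frm Q T m l δ v w) :
    ∃ d ⊆ BB k lam chi, ∃ w, Frm Q T m l (dcan δ0 c s d) v w := by
  classical
  obtain ⟨δ1, w1, h1, h2⟩ := Frm.reduce1 hp hT hC _ δ w h (Nat.lt_succ_self _)
  refine ⟨(BB k lam chi).filter (fun i => δ1 (s i) ≠ 0 ∧ ¬ ∃ y, δ1 (s i) = y ^ 2 + y),
    Finset.filter_subset _ _, ?_⟩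
  refine h1.shift hT _ (fun p hpl => ?_) (fun p => ?_)
  · rw [dcan, if_neg]
    rintro ⟨h3, h4⟩
    rw [Finset.mem_filter, ← h3] at h4
    exact h4.2.1 ((h1.nf p).d0 hpl)
  · by_cases hz : δ1 p = 0
    · refine ⟨0, ?_⟩
      rw [dcan, if_neg, hz]
      · simp
      · rintro ⟨h3, h4⟩
        rw [Finset.mem_filter, ← h3] at h4
        exact h4.2.1 hz
    · obtain ⟨h3, h4⟩ := h2 p hz
      by_cases hy : ∃ y, δ1 p = y ^ 2 + y
      · rw [dcan, if_neg]
        · obtain ⟨y, hy⟩ := hy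
          exact ⟨y, by rw [hy, add_assoc, add_self_zero]⟩
        · rintro ⟨-, h5⟩
          rw [Finset.mem_filter, ← h3] at h5
          exact h5.2.2 hy
      · rw [dcan, if_pos]
        · obtain ⟨y, hy'⟩ := (h0 (δ1 p)).resolve_left hy
          refine ⟨y, ?_⟩
          rw [add_assoc, ← hy', ← add_assoc, add_self_zero, zero_add]
        · refine ⟨h3, ?_⟩
          rw [Finset.mem_filter, ← h3]
          exact ⟨h4, hz, hy⟩

end cmb
end OrthoNil

namespace OrthoNil
open QuadraticMap
set_option linter.unusedSectionVars false

section char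
variable {F : Type*} [Field F] [Fintype F] [CharP F 2]

lemma perfF (x : F) : ∃ y, y ^ 2 = x := by
  obtain ⟨r, hr⟩ := FiniteField.isSquare_of_char_two (ringChar.eq F 2 ▸ rfl) x
  exact ⟨r, by rw [hr, pow_two]⟩

/-- Artin–Schreier map -/
def asmap (F : Type*) [Field F] [CharP F 2] : F →+ F where
  toFun x := x ^ 2 + x
  map_zero' := by simp
  map_add' x y := by rw [CharTwo.add_sq]; ring

lemma as_index : (asmap F).range.index = 2 := by
  have h1 := AddSubgroup.card_mul_index (asmap F).ker
  have h2 := AddSubgroup.index_ker (asmap F)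
  have h3 := AddSubgroup.card_mul_index (asmap F).range
  have h4 : Nat.card (asmap F).ker = 2 := by
    have : ((asmap F).ker : Set F) = {0, 1} := by
      ext x
      simp only [SetLike.mem_coe, AddMonoidHom.mem_ker, Set.mem_insert_iff, Set.mem_singleton_iff]
      change x ^ 2 + x = 0 ↔ _
      constructor
      · intro h
        have : x * (x + 1) = 0 := by rw [← h]; ring
        rcases mul_eq_zero.1 this with h | h
        · exact Or.inl h
        · exact Or.inr (eq_of_add_zero h)
      · rintro (rfl | rfl)
        · simp
        · rw [one_pow]; exact add_self_zero 1
    rw [← SetLike.coe_sort_coe, this, Nat.card_coe_set_eq, Set.ncard_pair zero_ne_one]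
  rw [h4, h2] at h1
  have h5 : 0 < Nat.card (asmap F).range := Nat.card_pos
  have h6 : Nat.card (asmap F).range * (asmap F).range.index = Nat.card (asmap F).range * 2 := by
    rw [h3, ← h1]; ring
  exact Nat.eq_of_mul_eq_mul_left h5 h6

open Classical in
/-- the additive character -/
noncomputable def psi (x : F) : ℤ := if x ∈ (asmap F).range then 1 else -1

lemma psi_add (x y : F) : psi (x + y) = psi x * psi y := by
  have h := AddSubgroup.add_mem_iff_of_index_two (as_index (F := F)) (a := x) (b := y)
  unfold psi
  by_cases hx : x ∈ (asmap F).range <;> by_cases hy : y ∈ (asmap F).range <;> simp [h, hx, hy]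

lemma psi_as (x : F) : psi (x ^ 2 + x) = 1 := if_pos ⟨x, rfl⟩

lemma psi_zero : psi (0 : F) = 1 := if_pos (zero_mem _)

lemma psi_sq (x : F) : psi (x ^ 2) = psi x := by
  have : x ^ 2 = (x ^ 2 + x) + x := by rw [add_assoc, add_self_zero, add_zero]
  rw [this, psi_add, psi_as, one_mul]

lemma psi_mul_self (x : F) : psi x * psi x = 1 := by
  rw [← psi_add, add_self_zero, psi_zero]

lemma psi_cases (x : F) : psi x = 1 ∨ psi x = -1 := by
  unfold psi; split_ifs <;> simp

lemma psi_one {x : F} (h : psi x = 1) : ∃ y, x = y ^ 2 + y := by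
  unfold psi at h
  split_ifs at h with hx
  · obtain ⟨y, hy⟩ := hx; exact ⟨y, hy.symm⟩

lemma exists_delta (F : Type*) [Field F] [Fintype F] [CharP F 2] : ∃ δ0 : F, psi δ0 = -1 := by
  by_contra hcon
  have : (asmap F).range = ⊤ := by
    rw [eq_top_iff]
    intro x _
    by_contra hx
    exact hcon ⟨x, if_neg hx⟩
  have h2 := as_index (F := F)
  rw [this] at h2
  simp at h2

lemma delta_or {δ0 : F} (h : psi δ0 = -1) (x : F) :
    (∃ y, x = y ^ 2 + y) ∨ (∃ y, x + δ0 = y ^ 2 + y) := by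
  rcases psi_cases x with h1 | h1
  · exact Or.inl (psi_one h1)
  · exact Or.inr (psi_one (by rw [psi_add, h1, h]; norm_num))

lemma psi_sum {ι : Type*} (s : Finset ι) (f : ι → F) : psi (∑ i ∈ s, f i) = ∏ i ∈ s, psi (f i) := by
  classical
  induction s using Finset.induction_on with
  | empty => simp [psi_zero]
  | insert a s ha ih => rw [Finset.sum_insert ha, Finset.prod_insert ha, psi_add, ih]

lemma sum_psi_lin {L : Type*} [AddCommGroup L] [Module F L] [Fintype L] (g : L →ₗ[F] F)
    (hg : g ≠ 0) : ∑ y, psi (g y) = 0 := by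
  obtain ⟨δ0, h0⟩ := exists_delta F
  obtain ⟨y0, hy0⟩ := LinearMap.surjective hg δ0
  have h1 : ∑ y, psi (g y) = ∑ y, psi (g (y + y0)) :=
    (Equiv.sum_comp (Equiv.addRight y0) (fun y => psi (g y))).symm
  have h2 : ∑ y, psi (g (y + y0)) = - ∑ y, psi (g y) := by
    rw [← Finset.sum_neg_distrib]
    refine Finset.sum_congr rfl fun y _ => ?_
    rw [map_add, psi_add, hy0, h0]; ring
  omega

variable {V : Type*} [AddCommGroup V] [Module F V] [Fintype V]

lemma gauss (f : QuadraticForm F V) (L : Submodule F V) (h1 : ∀ x ∈ L, f x = 0)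
    (h2 : ∀ x, (∀ y ∈ L, polar f x y = 0) → f x = 0) : 0 < ∑ x, psi (f x) := by
  classical
  have hL : (0 : ℤ) < Fintype.card L := by exact_mod_cast Fintype.card_pos
  have key : (Fintype.card L : ℤ) * ∑ x, psi (f x) =
      ∑ x, psi (f x) * ∑ y : L, psi (polar f x y) := by
    have : ∀ y : L, ∑ x, psi (f x) = ∑ x, psi (f x) * psi (polar f x y) := by
      intro y
      rw [← Equiv.sum_comp (Equiv.addRight (y : V)) (fun x => psi (f x))]
      refine Finset.sum_congr rfl fun x _ => ?_
      rw [Equiv.coe_addRight, qadd, h1 _ y.2, add_zero, psi_add]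
    calc (Fintype.card L : ℤ) * ∑ x, psi (f x) = ∑ y : L, ∑ x, psi (f x) := by simp
      _ = ∑ y : L, ∑ x, psi (f x) * psi (polar f x y) := Finset.sum_congr rfl fun y _ => this y
      _ = _ := by rw [Finset.sum_comm]; simp_rw [Finset.mul_sum]
  have hin : ∀ x, (∀ y ∈ L, polar f x y = 0) →
      psi (f x) * ∑ y : L, psi (polar f x y) = Fintype.card L := by
    intro x hx
    rw [h2 x hx, psi_zero, one_mul, Finset.sum_congr rfl fun y _ => by
      rw [hx y.1 y.2, psi_zero]]
    simp
  have hpos : 0 < ∑ x, psi (f x) * ∑ y : L, psi (polar f x y) := by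
    refine Finset.sum_pos' (fun x _ => ?_) ⟨0, Finset.mem_univ _, ?_⟩
    · by_cases hx : ∀ y ∈ L, polar f x y = 0
      · rw [hin x hx]; exact hL.le
      · have : ∑ y : L, psi (polar f x y) = 0 := by
          refine sum_psi_lin ((polarBilin f x).comp L.subtype) fun h0 => hx fun y hy => ?_
          exact LinearMap.congr_fun h0 ⟨y, hy⟩
        rw [this, mul_zero]
    · rw [hin 0 (fun y _ => by simp)]; exact hL
  rw [← key] at hpos
  exact pos_of_mul_pos_right hpos hL.le

end char

section gam
variable {F V : Type*} [Field F] [Fintype F] [CharP F 2] [AddCommGroup V] [Module F V]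
  [FiniteDimensional F V] [Fintype V]
variable {Q : QuadraticForm F V} {T : Module.End F V}
variable {P : Type} [Fintype P] [DecidableEq P] {m l : P → ℕ} {δ : P → F} {v w : P → V}

lemma polar_comp_pow (hT : Skew Q T) (a : ℕ) (x y : V) :
    polar (Q.comp (T ^ a)) x y = polar Q ((T ^ (2 * a)) x) y := by
  have : polar (Q.comp (T ^ a)) x y = polar Q ((T ^ a) x) ((T ^ a) y) := by simp [polar]
  rw [this, hT.ppow, two_mul]

lemma Frm.gamma (hT : Skew Q T) (h : Frm Q T m l δ v w) (a : ℕ)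
    (ha : ∀ p, l p ≤ a ∨ a + l p ≤ m p) :
    0 < psi (∑ p with a + l p ≤ m p, δ p) * ∑ x, psi (Q ((T ^ a) x)) := by
  classical
  choose r hr using fun p => perfF (δ p)
  have hr0 : ∀ p, 2 * l p = m p → r p = 0 := by
    intro p hp
    have := hr p
    rw [(h.nf p).d0 hp] at this
    exact pow_eq_zero_iff (two_ne_zero) |>.1 this
  let I : Finset P := Finset.univ.filter (fun p => a + l p ≤ m p)
  let u : V := ∑ p ∈ I, r p • (T ^ (l p - 1 - a)) (v p)
  let f : QuadraticForm F V := Q.comp (T ^ a)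
  have hf : ∀ x, f x = Q ((T ^ a) x) := fun x => rfl
  have hfp : ∀ x y, polar f x y = polar Q ((T ^ (2 * a)) x) y := polar_comp_pow hT a
  let g : V →ₗ[F] F := polarBilin f u
  have hg : ∀ x, g x = polar f u x := fun x => rfl
  let F0 : QuadraticForm F V := f + linMulLin g g
  have hF0 : ∀ x, F0 x = f x + g x ^ 2 := fun x => by simp [F0, pow_two]
  have hF0p : ∀ x y, polar F0 x y = polar f x y := by
    intro x y
    simp only [polar, hF0, map_add, CharTwo.add_sq]
    ring
  -- value at u
  have huv : ∀ s : Finset P, ∀ q b, polar Q ((T ^ b) (∑ p ∈ s, r p • (T ^ (l p - 1 - a)) (v p)))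
      (v q) = 0 := by
    intro s q b
    rw [map_sum, ← polarBilin_apply_apply, map_sum, LinearMap.sum_apply]
    refine Finset.sum_eq_zero fun p _ => ?_
    rw [polarBilin_apply_apply, map_smul, polar_smul_left, pow_pow_apply, h.vv hT, smul_zero]
  have hfu : f u = ∑ p ∈ I, δ p := by
    have : ∀ s ⊆ I, f (∑ p ∈ s, r p • (T ^ (l p - 1 - a)) (v p)) = ∑ p ∈ s, δ p := by
      intro s
      induction s using Finset.induction_on with
      | empty => intro _; simp
      | insert p s hp ih =>
        intro hs
        have hpI : p ∈ I := hs (Finset.mem_insert_self _ _)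
        rw [Finset.sum_insert hp, Finset.sum_insert hp, qadd,
          ih ((Finset.subset_insert _ _).trans hs), polar_comm, hfp, polar_smul_right,
          ← hT.adj_pow, pow_pow_apply, huv, smul_zero, add_zero]
        congr 1
        rw [QuadraticMap.map_smul, hf, pow_pow_apply, (h.nf p).Qv]
        by_cases h2 : 2 * l p = m p
        · rw [hr0 p h2, (h.nf p).d0 h2]; simp
        · have c1 := (Finset.mem_filter.1 hpI).2
          have c2 := (h.nf p).ml
          have c3 : a + (l p - 1 - a) + 1 = l p := by omega
          rw [if_pos c3, ← hr p]; simp [pow_two]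
    exact this I subset_rfl
  have hsum : ∑ x, psi (F0 x) = psi (∑ p ∈ I, δ p) * ∑ x, psi (Q ((T ^ a) x)) := by
    rw [← Equiv.sum_comp (Equiv.addRight u) (fun x => psi (Q ((T ^ a) x))), Finset.mul_sum]
    refine Finset.sum_congr rfl fun x _ => ?_
    rw [hF0, psi_add, psi_sq, Equiv.coe_addRight, ← hf, qadd, psi_add, psi_add, hfu, hg,
      polar_comm f u x]
    have := psi_mul_self (∑ p ∈ I, δ p)
    linear_combination (-psi (f x) * psi (polar f x u)) * this
  rw [← hsum]
  let Sw : Set V := {x | ∃ p b, x = (T ^ b) (w p)}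
  let Sv : Set V := {x | ∃ p c, m p ≤ c + 2 * a ∧ x = (T ^ c) (v p)}
  have hSall : ∀ x ∈ Submodule.span F (Sv ∪ Sw), F0 x = 0 := by
    refine isotropic_span ?_ ?_
    · rintro x (⟨p, c, hc, rfl⟩ | ⟨p, b, rfl⟩)
      · rw [hF0, hf, pow_pow_apply, (h.nf p).Qv, hg, hfp, hT.ppow, huv]
        have c1 := ha p
        have c2 : ¬ (a + c + 1 = l p) := by omega
        simp [c2]
      · rw [hF0, hf, pow_pow_apply, (h.nf p).Qw, hg, hfp, hT.ppow]
        have e : polar Q ((T ^ (2 * a + b)) u) (w p) =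
            if p ∈ I then (if a + b + l p = m p then r p else 0) else 0 := by
          simp only [u]
          rw [map_sum, ← polarBilin_apply_apply, map_sum, LinearMap.sum_apply]
          rw [← Finset.sum_ite_eq' I p (fun p => if a + b + l p = m p then r p else 0)]
          refine Finset.sum_congr rfl fun q hq => ?_
          rw [polarBilin_apply_apply, map_smul, polar_smul_left, pow_pow_apply, h.vw hT]
          by_cases hqp : q = p
          · subst hqp
            simp only [true_and, if_true]
            by_cases h2 : 2 * l q = m q
            · rw [hr0 q h2]; simp
            · have c1 := (Finset.mem_filter.1 hq).2
              have c2 := (h.nf q).ml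
              have c3 : (2 * a + b + (l q - 1 - a) + 1 = m q) ↔ a + b + l q = m q := by omega
              simp only [c3]; split_ifs <;> simp
          · simp [hqp]
        rw [e]
        by_cases hpI : p ∈ I
        · rw [if_pos hpI]
          split_ifs
          · rw [hr]; exact add_self_zero _
          · simp
        · have c1 : ¬ (a + l p ≤ m p) := fun hc => hpI (by simp [I, hc])
          have c2 : ¬ (a + b + l p = m p) := by omega
          simp [c2]
    · rintro x (⟨p, c, hc, rfl⟩ | ⟨p, b, rfl⟩) y (⟨q, d, hd, rfl⟩ | ⟨q, d, rfl⟩)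
      · rw [hF0p, hfp, pow_pow_apply, hT.ppow, h.vv hT]
      · rw [hF0p, hfp, pow_pow_apply, pow_zero_of_le (h.nf p).hv (by omega), polar_zero_left]
      · rw [polar_comm, hF0p, hfp, pow_pow_apply, pow_zero_of_le (h.nf q).hv (by omega),
          polar_zero_left]
      · rw [hF0p, hfp, pow_pow_apply, hT.ppow, h.ww hT]
  refine gauss F0 (Submodule.span F Sw)
    (fun x hx => hSall x (Submodule.span_mono Set.subset_union_right hx)) fun x hx => hSall x ?_
  rw [← (h.basis hT).sum_repr x]
  refine Submodule.sum_mem _ fun i _ => ?_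
  obtain ⟨p, c, s⟩ := i
  rw [h.basis_apply]
  cases s
  · by_cases hc : m p ≤ c + 2 * a
    · exact Submodule.smul_mem _ _ (Submodule.subset_span (Or.inl ⟨p, c, hc, rfl⟩))
    · have hcc := c.2
      have : (h.basis hT).repr x ⟨p, c, false⟩ = 0 := by
        rw [h.repr]
        have h3 := hx ((T ^ (m p - 1 - c - 2 * a)) (w p)) (Submodule.subset_span ⟨p, _, rfl⟩)
        rw [hF0p, hfp, hT.adj_pow, pow_pow_apply] at h3
        have e : 2 * a + (m p - 1 - c - 2 * a) = m p - (c + 1) := by omega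
        rw [e] at h3
        simpa [ev, Idx.dual, Fin.val_rev] using h3
      rw [this, zero_smul]; exact zero_mem _
  · exact Submodule.smul_mem _ _ (Submodule.subset_span (Or.inr ⟨p, c, rfl⟩))

end gam
end OrthoNil

namespace OrthoNil
open QuadraticMap
set_option linter.unusedSectionVars false

section sign
variable {F V : Type*} [Field F] [Fintype F] [CharP F 2] [AddCommGroup V] [Module F V]
  [FiniteDimensional F V] [Fintype V]
variable {Q : QuadraticForm F V} {T : Module.End F V}
variable {P : Type} [Fintype P] [DecidableEq P] {m l : P → ℕ} {v w : P → V}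
variable {k : ℕ} {lam chi : ℕ → ℕ} {c : P → ℕ} {s : ℕ → P} {δ0 : F} {d : Finset ℕ}

lemma psi_dcan (h0 : psi δ0 = -1) (hC : Cmb m l k lam chi c s) (hd : d ⊆ Finset.range k) (a : ℕ) :
    psi (∑ p with a + l p ≤ m p, dcan δ0 c s d p) =
      (-1) ^ (d.filter (fun i => a + chi i ≤ lam i)).card := by
  rw [psi_sum]
  have : ∀ p, psi (dcan δ0 c s d p) = if p = s (c p) ∧ c p ∈ d then -1 else 1 := by
    intro p
    unfold dcan
    split_ifs
    · exact h0
    · exact psi_zero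
  simp only [this]
  rw [Finset.prod_ite, Finset.prod_const, Finset.prod_const_one, mul_one]
  congr 1
  refine Finset.card_nbij' c s ?_ ?_ ?_ ?_
  · intro p hp
    simp only [Finset.coe_filter, Finset.mem_filter, Finset.mem_univ, true_and,
      Set.mem_setOf_eq] at hp ⊢
    exact ⟨hp.2.2, by rw [← hC.mc, ← hC.lc]; exact hp.1⟩
  · intro i hi
    simp only [Finset.coe_filter, Finset.mem_filter, Finset.mem_univ, true_and,
      Set.mem_setOf_eq] at hi ⊢
    have := hC.cs i (Finset.mem_range.1 (hd hi.1))
    rw [hC.mc, hC.lc, this]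
    exact ⟨hi.2, rfl, hi.1⟩
  · intro p hp
    simp only [Finset.coe_filter, Finset.mem_filter, Finset.mem_univ, true_and,
      Set.mem_setOf_eq] at hp
    exact hp.2.1.symm
  · intro i hi
    simp only [Finset.coe_filter, Set.mem_setOf_eq] at hi
    exact hC.cs i (Finset.mem_range.1 (hd hi.1))

lemma BB_sub : BB k lam chi ⊆ Finset.range k := Finset.filter_subset _ _

lemma Frm.sign0 (h0 : psi δ0 = -1) (hT : Skew Q T) (hC : Cmb m l k lam chi c s)
    (hd : d ⊆ Finset.range k) (h : Frm Q T m l (dcan δ0 c s d) v w) :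
    0 < (-1) ^ d.card * ∑ x, psi (Q x) := by
  have := h.gamma hT 0 (fun p => Or.inr (by have := (h.nf p).lm; omega))
  rw [psi_dcan h0 hC hd] at this
  have e : d.filter (fun i => 0 + chi i ≤ lam i) = d := by
    refine Finset.filter_true_of_mem fun i hi => ?_
    have := hC.lm i (Finset.mem_range.1 (hd hi)); omega
  rw [e] at this
  simpa using this

lemma Frm.sign (h0 : psi δ0 = -1) (hT : Skew Q T) (hC : Cmb m l k lam chi c s)
    (hd : d ⊆ BB k lam chi) (h : Frm Q T m l (dcan δ0 c s d) v w) {i : ℕ}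
    (hi : i ∈ BB k lam chi) :
    0 < (-1) ^ (d.filter (fun j => j ≤ i)).card *
      ∑ x, psi (Q ((T ^ (if i + 1 < k then chi (i + 1) else 0)) x)) := by
  obtain ⟨hik, hi1, hi2⟩ : i < k ∧ chi i + (if i + 1 < k then chi (i + 1) else 0) ≤ lam i ∧
      2 * chi i ≠ lam i := by
    simpa [BB] using hi
  generalize ha : (if i + 1 < k then chi (i + 1) else 0) = a at *
  have hle : ∀ j, j ≤ i → a + chi j ≤ lam j := by
    intro j hj
    rcases hj.lt_or_eq with hj | rfl
    · have := hC.sub j i hj hik; omega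
    · omega
  have hge : ∀ j, i < j → j < k → chi j ≤ a := by
    intro j hj hjk
    have hk : i + 1 < k := by omega
    rw [if_pos hk] at ha
    rcases (Nat.succ_le_of_lt hj).lt_or_eq with hj | hj
    · have := hC.mono (i + 1) j hj hjk; omega
    · have : j = i + 1 := hj.symm
      subst this; omega
  have := h.gamma hT a (fun p => by
    rw [hC.lc, hC.mc]
    by_cases hj : c p ≤ i
    · exact Or.inr (hle _ hj)
    · exact Or.inl (hge _ (by omega) (hC.ck p)))
  rw [psi_dcan h0 hC (hd.trans BB_sub)] at this
  have e : d.filter (fun j => a + chi j ≤ lam j) = d.filter (fun j => j ≤ i) := by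
    refine Finset.filter_congr fun j hj => ⟨fun h1 => ?_, hle j⟩
    by_contra hcon
    have hjB := hd hj
    obtain ⟨hjk, hj1, hj2⟩ : j < k ∧ chi j + (if j + 1 < k then chi (j + 1) else 0) ≤ lam j ∧
      2 * chi j ≠ lam j := by simpa [BB] using hjB
    have e1 := hge j (by omega) hjk
    have e2 := hC.ml j hjk
    omega
  rwa [e] at this

lemma neg_one_pow_sign {a b : ℕ} {g : ℤ} (h1 : 0 < (-1) ^ a * g) (h2 : 0 < (-1) ^ b * g) :
    (-1 : ℤ) ^ a = (-1) ^ b := by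
  rcases neg_one_pow_eq_or ℤ a with ha | ha <;> rcases neg_one_pow_eq_or ℤ b with hb | hb <;>
    rw [ha] at h1 ⊢ <;> rw [hb] at h2 ⊢ <;> omega

lemma filter_unique {B d d' : Finset ℕ} (hd : d ⊆ B) (hd' : d' ⊆ B)
    (h : ∀ i ∈ B, (-1 : ℤ) ^ (d.filter (fun j => j ≤ i)).card =
      (-1) ^ (d'.filter (fun j => j ≤ i)).card) : d = d' := by
  have key : ∀ i, i ∈ d ↔ i ∈ d' := by
    intro i
    induction i using Nat.strong_induction_on with
    | _ i ih =>
    by_cases hi : i ∈ B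
    · have hlt : d.filter (fun j => j < i) = d'.filter (fun j => j < i) := by
        ext j
        simp only [Finset.mem_filter]
        constructor
        · rintro ⟨h1, h2⟩; exact ⟨(ih j h2).1 h1, h2⟩
        · rintro ⟨h1, h2⟩; exact ⟨(ih j h2).2 h1, h2⟩
      have hcard : ∀ d : Finset ℕ, (d.filter (fun j => j ≤ i)).card =
          (d.filter (fun j => j < i)).card + if i ∈ d then 1 else 0 := by
        intro d
        split_ifs with hid
        · have : d.filter (fun j => j ≤ i) = insert i (d.filter (fun j => j < i)) := by
            ext j
            simp only [Finset.mem_filter, Finset.mem_insert]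
            constructor
            · rintro ⟨h1, h2⟩
              rcases h2.lt_or_eq with h3 | h3
              · exact Or.inr ⟨h1, h3⟩
              · exact Or.inl h3
            · rintro (rfl | ⟨h1, h2⟩)
              · exact ⟨hid, le_rfl⟩
              · exact ⟨h1, h2.le⟩
          rw [this, Finset.card_insert_of_notMem (by simp)]
        · rw [add_zero]
          congr 1
          refine Finset.filter_congr fun j hj => ⟨fun h1 => lt_of_le_of_ne h1 ?_, le_of_lt⟩
          rintro rfl; exact hid hj
      have h1 := h i hi
      rw [hcard, hcard, hlt, pow_add, pow_add] at h1
      have h2 := mul_left_cancel₀ (pow_ne_zero _ (by norm_num)) h1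
      by_cases a1 : i ∈ d <;> by_cases a2 : i ∈ d' <;> simp [a1, a2] at h2 ⊢
    · exact ⟨fun h => absurd (hd h) hi, fun h => absurd (hd' h) hi⟩
  ext i; exact key i

lemma Frm.unique {T2 : Module.End F V} {d2 : Finset ℕ} {v2 w2 : P → V}
    (h0 : psi δ0 = -1) (hT : Skew Q T) (hT2 : Skew Q T2)
    (hC : Cmb m l k lam chi c s)
    (hd : d ⊆ BB k lam chi) (h : Frm Q T m l (dcan δ0 c s d) v w)
    (hd2 : d2 ⊆ BB k lam chi) (h2 : Frm Q T2 m l (dcan δ0 c s d2) v2 w2)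
    (hconj : Q.OConj T T2) : d = d2 := by
  obtain ⟨g, hg, hgT⟩ := hconj
  have hpow : ∀ a x, (T2 ^ a) (g x) = g ((T ^ a) x) := by
    intro a
    induction a with
    | zero => simp
    | succ a ih =>
      intro x
      rw [pow_succ', Module.End.mul_apply, ih, pow_succ', Module.End.mul_apply, hgT]
      simp
  have hsum : ∀ a, ∑ x, psi (Q ((T2 ^ a) x)) = ∑ x, psi (Q ((T ^ a) x)) := by
    intro a
    rw [← Equiv.sum_comp g.toEquiv]
    refine Finset.sum_congr rfl fun x _ => ?_
    rw [LinearEquiv.coe_toEquiv, hpow, hg]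
  refine filter_unique hd hd2 fun i hi => ?_
  have e1 := h.sign h0 hT hC hd hi
  have e2 := h2.sign h0 hT2 hC hd2 hi
  rw [hsum] at e2
  exact neg_one_pow_sign e1 e2

end sign

section nondeg
variable {K V : Type*} [Field K] [CharP K 2] [AddCommGroup V] [Module K V] [FiniteDimensional K V]
variable {Q : QuadraticForm K V}

lemma skew_zero : Skew Q 0 := fun x => by simp

lemma nondeg_of (h : Q.IsNondegenerateFormSpace) {n : ℕ} (hn : Module.finrank K V = 2 * n) :
    ∀ x, (∀ y, polar Q x y = 0) → x = 0 := by
  obtain ⟨-, h1, -⟩ := h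
  have hmem : ∀ x, x ∈ Q.polarRadical ↔ ∀ y, polar Q x y = 0 := by
    intro x
    unfold QuadraticForm.polarRadical
    rw [LinearMap.mem_ker]
    constructor
    · intro h y; exact LinearMap.congr_fun h y
    · intro h; ext y; exact h y
  obtain ⟨U, hU⟩ := Submodule.exists_isCompl Q.polarRadical
  have hdim := Submodule.finrank_add_eq_of_isCompl hU
  obtain ⟨P, iF, iD, m, v, w, hPr, hC, hB, hs⟩ := exists_rel_aux (Q := Q) (T := 0) skew_zero
    (IsNilpotent.zero) _ U le_rfl (by simp) (fun x hx hxy => by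
      have : x ∈ Q.polarRadical ⊓ U := by
        refine ⟨(hmem x).2 fun y => ?_, hx⟩
        have hy : y ∈ Q.polarRadical ⊔ U := by rw [hU.sup_eq_top]; trivial
        obtain ⟨a, ha, b, hb, rfl⟩ := Submodule.mem_sup.1 hy
        rw [polar_add_right, hxy b hb, polar_comm, (hmem a).1 ha, add_zero]
      rwa [hU.inf_eq_bot] at this)
  have hUs : U = Submodule.span K (Set.range (ev (0 : Module.End K V) v w (m := m))) := by
    refine le_antisymm (hs.trans (iSup_le fun p => blk_le_ev hPr p)) (Submodule.span_le.2 ?_)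
    rintro _ ⟨⟨p, a, s⟩, rfl⟩
    refine hB p ?_
    cases s
    · exact Blk.v_mem _ _ _
    · exact Blk.w_mem _ _ _
  have hdU : Module.finrank K U = ∑ p, 2 * m p := by
    rw [hUs, finrank_span_eq_card (ev_li skew_zero hPr hC), card_idx]
  rw [← Finset.mul_sum] at hdU
  have hR : Module.finrank K Q.polarRadical = 0 := by omega
  rw [Submodule.finrank_eq_zero] at hR
  intro x hx
  have := (hmem x).2 hx
  rwa [hR, Submodule.mem_bot] at this

lemma zero_frm0 (hp : ∀ x : K, ∃ y, y ^ 2 = x) {n : ℕ} (hn : Module.finrank K V = 2 * n)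
    (hnd : ∀ x, (∀ y, polar Q x y = 0) → x = 0) :
    ∃ (δ : Fin n → K) (v w : Fin n → V), Frm Q 0 (fun _ => 1) (fun _ => 1) δ v w := by
  obtain ⟨P, iF, iD, m, l, δ, v, w, h⟩ := exists_frm hp skew_zero IsNilpotent.zero hnd
  have hm : m = fun _ => 1 := by
    funext p
    have hpos := (h.nf p).pos
    by_contra hne
    have hne' : m p ≠ 1 := hne
    have h1 := (h.nf p).vw (m p - 1)
    rw [zero_pow (by omega), if_pos (by omega)] at h1
    simp at h1
  have hl : l = fun _ => 1 := by
    funext p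
    have h1 := (h.nf p).ml
    have h2 := (h.nf p).lm
    have h3 := (h.nf p).pos
    have h4 : m p = 1 := by rw [hm]
    change l p = 1
    omega
  subst hm; subst hl
  have hcard : Fintype.card (Fin n) = Fintype.card P := by
    have := h.dim
    rw [hn] at this
    simp at this ⊢
    omega
  exact ⟨_, _, _, h.reindex (Fintype.equivOfCardEq hcard)⟩

end nondeg

section ts
variable {F V : Type*} [Field F] [Fintype F] [CharP F 2] [AddCommGroup V] [Module F V]
  [FiniteDimensional F V]
variable {Q : QuadraticForm F V}

lemma cmb_one {n : ℕ} [NeZero n] : Cmb (fun _ : Fin n => 1) (fun _ => 1) 1 (fun _ => 1) (fun _ => 1)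
    (fun _ => 0) (fun _ => 0) := by
  constructor <;> intros <;> first | rfl | omega

lemma zero_frm {δ0 : F} (h0 : psi δ0 = -1) {n : ℕ} [NeZero n] (hn : Module.finrank F V = 2 * n)
    (hnd : ∀ x, (∀ y, polar Q x y = 0) → x = 0) :
    ∃ d ⊆ ({0} : Finset ℕ), ∃ (v w : Fin n → V), Frm Q 0 (fun _ => 1) (fun _ => 1)
      (dcan δ0 (fun _ => 0) (fun _ => 0) d) v w := by
  obtain ⟨δ, v, w, h⟩ := zero_frm0 perfF hn hnd
  obtain ⟨d, hd, w', h'⟩ := h.reduce perfF δ0 (delta_or h0) skew_zero cmb_one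
  refine ⟨d, ?_, v, w', h'⟩
  have := hd.trans BB_sub
  simpa using this

lemma gamma_pos_of_ts [Fintype V] {n : ℕ} (hn : Module.finrank F V = 2 * n)
    (hnd : ∀ x, (∀ y, polar Q x y = 0) → x = 0) (hW : Q.HasTotallySingularSubspace n) :
    0 < ∑ x, psi (Q x) := by
  obtain ⟨W, hW1, hW2⟩ := hW
  have hWW : ∀ x ∈ W, ∀ y ∈ W, polar Q x y = 0 := fun x hx y hy => by
    simp [polar, hW2 x hx, hW2 y hy, hW2 _ (add_mem hx hy)]
  refine gauss Q W hW2 fun x hx => hW2 x ?_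
  have hnd' : LinearMap.BilinForm.Nondegenerate (polarBilin Q) := by
    constructor
    · intro x h; exact hnd x h
    · intro x h; exact hnd x fun y => by rw [polar_comm]; exact h y
  have hrefl : LinearMap.BilinForm.IsRefl (polarBilin Q) := fun x y h => by
    rw [polarBilin_apply_apply, polar_comm]; exact h
  have e := LinearMap.BilinForm.finrank_orthogonal hnd' W
  have hle : W ≤ LinearMap.BilinForm.orthogonal (polarBilin Q) W := fun y hy z hz => hWW z hz y hy
  have heq := Submodule.eq_of_le_of_finrank_eq hle (by rw [e, hW1, hn]; omega)
  rw [heq]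
  intro y hy
  change polar Q y x = 0
  rw [polar_comm]; exact hx y hy

lemma ts_of_gamma_pos [Fintype V] {n : ℕ} [NeZero n] (hn : Module.finrank F V = 2 * n)
    (hnd : ∀ x, (∀ y, polar Q x y = 0) → x = 0) (hG : 0 < ∑ x, psi (Q x)) :
    Q.HasTotallySingularSubspace n := by
  obtain ⟨δ0, h0⟩ := exists_delta F
  obtain ⟨d, hd, v, w, h⟩ := zero_frm h0 hn hnd
  have hs := h.sign0 h0 skew_zero cmb_one (by simpa using hd)
  have hd0 : d = ∅ := by
    rcases Finset.subset_singleton_iff.1 hd with h1 | h1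
    · exact h1
    · rw [h1] at hs; simp at hs; omega
  subst hd0
  refine ⟨Submodule.span F (Set.range w), ?_, isotropic_span ?_ ?_⟩
  · have hli : LinearIndependent F w := by
      have := (ev_li skew_zero h.pr h.cr).comp (fun p : Fin n => (⟨p, 0, true⟩ : Idx fun _ => 1))
        (fun p q hpq => congrArg Sigma.fst hpq)
      have e : (ev (0 : Module.End F V) v w ∘
        (fun p : Fin n => (⟨p, 0, true⟩ : Idx fun _ => 1))) = w := by
        funext p; simp [ev]
      rwa [e] at this
    rw [finrank_span_eq_card hli, Fintype.card_fin]
  · rintro _ ⟨p, rfl⟩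
    have := (h.nf p).Qw 0
    simpa [dcan] using this
  · rintro _ ⟨p, rfl⟩ _ ⟨q, rfl⟩
    simpa using h.ww skew_zero p q 0

end ts

section isom0
variable {F V V2 : Type*} [Field F] [Fintype F] [CharP F 2] [AddCommGroup V] [Module F V]
  [FiniteDimensional F V] [AddCommGroup V2] [Module F V2] [FiniteDimensional F V2]
  [Fintype V] [Fintype V2]
variable {Q : QuadraticForm F V} {Q2 : QuadraticForm F V2}

lemma isom_of_sign {n : ℕ} [NeZero n] (hn : Module.finrank F V = 2 * n)
    (hn2 : Module.finrank F V2 = 2 * n)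
    (hnd : ∀ x, (∀ y, polar Q x y = 0) → x = 0) (hnd2 : ∀ x, (∀ y, polar Q2 x y = 0) → x = 0)
    {a : ℕ} (h1 : 0 < (-1) ^ a * ∑ x, psi (Q x)) (h2 : 0 < (-1) ^ a * ∑ x, psi (Q2 x)) :
    ∃ g : V ≃ₗ[F] V2, ∀ x, Q2 (g x) = Q x := by
  obtain ⟨δ0, h0⟩ := exists_delta F
  obtain ⟨d, hd, v, w, h⟩ := zero_frm h0 hn hnd
  obtain ⟨d2, hd2, v2, w2, h'⟩ := zero_frm h0 hn2 hnd2
  have hs := h.sign0 h0 skew_zero cmb_one (by simpa using hd)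
  have hs2 := h'.sign0 h0 skew_zero cmb_one (by simpa using hd2)
  have e := (neg_one_pow_sign hs h1).trans (neg_one_pow_sign hs2 h2).symm
  have hdd : d = d2 := by
    rcases Finset.subset_singleton_iff.1 hd with h3 | h3 <;>
    rcases Finset.subset_singleton_iff.1 hd2 with h4 | h4 <;> rw [h3, h4] at e <;> rw [h3, h4] <;> exact absurd e (by norm_num)
  subst hdd
  obtain ⟨g, hg, -⟩ := h.isom skew_zero skew_zero h'
  exact ⟨g, hg⟩

end isom0
end OrthoNil

namespace OrthoNil
open QuadraticMap
set_option linter.unusedSectionVars false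

section model
variable {F K V' : Type*} [Field F] [CharP F 2] [Field K] [CharP K 2] [Algebra F K]
  [AddCommGroup V'] [Module K V'] [FiniteDimensional K V']
variable {Q' : QuadraticForm K V'} {T' : Module.End K V'}
variable {P : Type} [Fintype P] [DecidableEq P] {m l : P → ℕ} {δ : P → F} {v' w' : P → V'}

def semiSum {ι : Type*} [Fintype ι] (b : ι → V') : (ι → F) →ₛₗ[algebraMap F K] V' where
  toFun x := ∑ i, algebraMap F K (x i) • b i
  map_add' x y := by simp [add_smul, Finset.sum_add_distrib]
  map_smul' a x := by simp [Finset.smul_sum, mul_smul]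

lemma semiSum_single {ι : Type*} [Fintype ι] [DecidableEq ι] (b : ι → V') (i : ι) :
    semiSum (F := F) (K := K) b (Pi.single i 1) = b i := by
  change ∑ j, algebraMap F K ((Pi.single i (1 : F) : ι → F) j) • b j = b i
  rw [Finset.sum_eq_single i]
  · simp
  · intro j _ hj; simp [hj]
  · simp

lemma semiSum_inj {ι : Type*} [Fintype ι] {b : ι → V'} (hb : LinearIndependent K b) (x : ι → F)
    (h : semiSum (F := F) (K := K) b x = 0) : x = 0 := by
  funext i
  have := Fintype.linearIndependent_iff.1 hb (fun i => algebraMap F K (x i)) h i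
  simpa using this

lemma semiSum_polar {ι : Type*} [Fintype ι] {b : ι → V'}
    (hp : ∀ i j, ∃ a : F, polar Q' (b i) (b j) = algebraMap F K a) (s t : Finset ι) (x y : ι → F) :
    ∃ a : F, polar Q' (∑ i ∈ s, algebraMap F K (x i) • b i) (∑ i ∈ t, algebraMap F K (y i) • b i)
      = algebraMap F K a := by
  choose B hB using hp
  refine ⟨∑ i ∈ s, ∑ j ∈ t, x i * (y j * B i j), ?_⟩
  rw [← polarBilin_apply_apply]
  simp only [map_sum, LinearMap.sum_apply, map_smul, LinearMap.smul_apply, polarBilin_apply_apply,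
    hB, smul_eq_mul, map_mul]
  rw [Finset.sum_comm]
  refine Finset.sum_congr rfl fun i _ => ?_
  rw [Finset.mul_sum]
  refine Finset.sum_congr rfl fun j _ => ?_
  ring

lemma semiSum_Q {ι : Type*} [Fintype ι] {b : ι → V'}
    (hp : ∀ i j, ∃ a : F, polar Q' (b i) (b j) = algebraMap F K a)
    (hq : ∀ i, ∃ a : F, Q' (b i) = algebraMap F K a) (x : ι → F) :
    ∃ a : F, Q' (semiSum (F := F) (K := K) b x) = algebraMap F K a := by
  classical
  change ∃ a : F, Q' (∑ i, algebraMap F K (x i) • b i) = algebraMap F K a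
  induction (Finset.univ : Finset ι) using Finset.induction_on with
  | empty => exact ⟨0, by simp⟩
  | insert i s hi ih =>
    obtain ⟨a, ha⟩ := ih
    obtain ⟨c, hc⟩ := hq i
    obtain ⟨e, he⟩ := semiSum_polar hp {i} s x x
    rw [Finset.sum_singleton] at he
    refine ⟨x i * x i * c + a + e, ?_⟩
    rw [Finset.sum_insert hi, qadd, he, ha, QuadraticMap.map_smul, hc]
    simp

lemma exists_model (hT' : Skew Q' T') (hnil : IsNilpotent T')
    (hnd : ∀ x, (∀ y, polar Q' x y = 0) → x = 0)
    (h' : Frm Q' T' m l (fun p => algebraMap F K (δ p)) v' w') :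
    ∃ (Q : QuadraticForm F (Idx m → F)) (T : Module.End F (Idx m → F)) (v w : P → Idx m → F),
      Skew Q T ∧ IsNilpotent T ∧ (∀ x, (∀ y, polar Q x y = 0) → x = 0) ∧ Frm Q T m l δ v w := by
  classical
  set b := ev T' v' w' (m := m) with hb
  set σ := semiSum (F := F) (K := K) b with hσ
  have hli : LinearIndependent K b := ev_li hT' h'.pr h'.cr
  have inj : ∀ x, σ x = 0 → x = 0 := semiSum_inj hli
  have inj' : ∀ x y, σ x = σ y → x = y := fun x y hxy => by
    have := inj (x - y) (by rw [map_sub, hxy, sub_self])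
    exact sub_eq_zero.1 this
  have finj : Function.Injective (algebraMap F K) := (algebraMap F K).injective
  have hQ : ∀ x, ∃ a : F, Q' (σ x) = algebraMap F K a := by
    refine semiSum_Q (fun i j => ?_) (fun i => ?_)
    · rw [hb, polar_ev hT' h'.pr h'.cr]
      split_ifs
      · exact ⟨1, by simp⟩
      · exact ⟨0, by simp⟩
    · rw [hb, Q_ev h']
      split_ifs
      · exact ⟨_, rfl⟩
      · exact ⟨0, by simp⟩
      · exact ⟨1, by simp⟩
      · exact ⟨0, by simp⟩
  choose q hq using hQ
  have hbr : ∀ p a, (∃ x, σ x = (T' ^ a) (v' p)) ∧ (∃ x, σ x = (T' ^ a) (w' p)) := by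
    intro p a
    by_cases ha : a < m p
    · exact ⟨⟨Pi.single ⟨p, ⟨a, ha⟩, false⟩ 1, by rw [hσ, semiSum_single, hb]; simp [ev]⟩,
        ⟨Pi.single ⟨p, ⟨a, ha⟩, true⟩ 1, by rw [hσ, semiSum_single, hb]; simp [ev]⟩⟩
    · exact ⟨⟨0, by rw [map_zero, pow_zero_of_le (h'.pr p).hv (by omega)]⟩,
        ⟨0, by rw [map_zero, pow_zero_of_le (h'.pr p).hw (by omega)]⟩⟩
  have hTb : ∀ i, ∃ x, σ x = T' (b i) := by
    rintro ⟨p, a, s⟩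
    cases s
    · obtain ⟨x, hx⟩ := (hbr p (a + 1)).1
      exact ⟨x, by rw [hx, hb, pow_succ', Module.End.mul_apply]; simp [ev]⟩
    · obtain ⟨x, hx⟩ := (hbr p (a + 1)).2
      exact ⟨x, by rw [hx, hb, pow_succ', Module.End.mul_apply]; simp [ev]⟩
  choose tb htb using hTb
  have hTx : ∀ x, ∃ y, σ y = T' (σ x) := by
    intro x
    refine ⟨∑ i, x i • tb i, ?_⟩
    rw [map_sum]
    change _ = T' (∑ i, algebraMap F K (x i) • b i)
    rw [map_sum]
    refine Finset.sum_congr rfl fun i _ => ?_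
    rw [map_smulₛₗ, htb, map_smul]
  choose t ht using hTx
  have hpol : ∀ x y, algebraMap F K (polar q x y) = polar Q' (σ x) (σ y) := by
    intro x y
    simp only [polar, map_sub, ← hq, map_add]
  let Q : QuadraticForm F (Idx m → F) := QuadraticMap.ofPolar q
    (fun a x => finj (by
      rw [← hq, map_smulₛₗ, QuadraticMap.map_smul, hq]; simp))
    (fun x x' y => finj (by rw [map_add, hpol, hpol, hpol, map_add, polar_add_left]))
    (fun a x y => finj (by
      rw [hpol, map_smulₛₗ, polar_smul_left, ← hpol]; simp))
  let T : Module.End F (Idx m → F) :=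
    { toFun := t
      map_add' := fun x y => inj' _ _ (by rw [ht, map_add, map_add, map_add, ht, ht])
      map_smul' := fun a x => inj' _ _ (by simp [ht]) }
  have hσQ : ∀ x, Q' (σ x) = algebraMap F K (Q x) := hq
  have hσT : ∀ x, σ (T x) = T' (σ x) := ht
  have hP : ∀ x y, polar Q' (σ x) (σ y) = algebraMap F K (polar Q x y) := semi_polar hσQ
  have hpw := semi_pow hσT
  choose v hv using fun p => (hbr p 0).1
  choose w hw using fun p => (hbr p 0).2
  simp only [pow_zero, Module.End.one_apply] at hv hw
  have hsk : Skew Q T := fun x => finj (by rw [← hP, hσT, hT', map_zero])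
  refine ⟨Q, T, v, w, hsk, ?_, ?_, ⟨fun p => ?_, Cross.of_gens hsk ?_, ?_⟩⟩
  · obtain ⟨N, hN⟩ := hnil
    refine ⟨N, LinearMap.ext fun x => inj _ ?_⟩
    rw [← hpw, hN]; rfl
  · intro x hx
    refine inj x (hnd _ fun y => ?_)
    have : y ∈ Submodule.span K (Set.range b) := by
      have := (h'.basis hT').span_eq
      have e : (⇑(h'.basis hT')) = b := funext fun i => h'.basis_apply hT' i
      rw [e] at this
      rw [this]; trivial
    rw [polar_comm]
    refine polar_span_zero (σ x) ?_ y this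
    rintro _ ⟨i, rfl⟩
    rw [← semiSum_single (F := F) (K := K) b i, ← hσ, hP, polar_comm, hx, map_zero]
  · have hn := h'.nf p
    refine ⟨⟨hn.pos, inj _ ?_, inj _ ?_, fun a => finj ?_⟩, hn.ml, hn.lm, fun a => finj ?_,
      fun a => finj ?_, fun h => finj ?_⟩
    · rw [← hpw, hv, hn.hv]
    · rw [← hpw, hw, hn.hw]
    · rw [← hP, ← hpw, hv, hw, hn.vw]; split_ifs <;> simp
    · rw [← hσQ, ← hpw, hv, hn.Qv]; split_ifs <;> simp
    · rw [← hσQ, ← hpw, hw, hn.Qw]; split_ifs <;> simp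
    · rw [hn.d0 h, map_zero]
  · intro p r hpr a
    refine ⟨finj ?_, finj ?_, finj ?_⟩
    · rw [← hP, ← hpw, hv, hv, map_zero]
      exact h'.cr p r hpr _ (Blk.v_mem _ _ _) _ (Blk.v_mem' _ _)
    · rw [← hP, ← hpw, hv, hw, map_zero]
      exact h'.cr p r hpr _ (Blk.v_mem _ _ _) _ (Blk.w_mem' _ _)
    · rw [← hP, ← hpw, hw, hw, map_zero]
      exact h'.cr p r hpr _ (Blk.w_mem _ _ _) _ (Blk.w_mem' _ _)
  · rw [Module.finrank_fintype_fun_eq_card, card_idx]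

end model
end OrthoNil

namespace OrthoNil
open QuadraticMap
set_option linter.unusedSectionVars false

section count
variable {F K V' V : Type*} [Field F] [Fintype F] [CharP F 2] [Field K] [CharP K 2] [Algebra F K]
  [IsAlgClosed K]
  [AddCommGroup V'] [Module K V'] [FiniteDimensional K V']
  [AddCommGroup V] [Module F V] [FiniteDimensional F V] [Fintype V]
variable {Q' : QuadraticForm K V'} {T' : Module.End K V'}
variable {P : Type} [Fintype P] [DecidableEq P] {m l : P → ℕ} {δ' : P → K} {v' w' : P → V'}
variable {k : ℕ} {lam chi : ℕ → ℕ} {c : P → ℕ} {s : ℕ → P} {δ0 : F}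
variable {Q : QuadraticForm F V}

lemma as_solve (x : K) : ∃ y : K, x = y ^ 2 + y := by
  have hd : (Polynomial.X ^ 2 + (Polynomial.X + Polynomial.C (-x)) : Polynomial K).degree = 2 := by
    rw [Polynomial.degree_add_eq_left_of_degree_lt]
    · simp
    · rw [Polynomial.degree_X_add_C, Polynomial.degree_X_pow]; norm_num
  obtain ⟨y, hy⟩ := IsAlgClosed.exists_root
    (Polynomial.X ^ 2 + (Polynomial.X + Polynomial.C (-x)) : Polynomial K) (by rw [hd]; norm_num)
  refine ⟨y, ?_⟩
  simp [Polynomial.IsRoot] at hy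
  linear_combination -hy

lemma realize {n : ℕ} [NeZero n] (hn : Module.finrank F V = 2 * n)
    (hn' : Module.finrank K V' = 2 * n) (hnd : ∀ x, (∀ y, polar Q x y = 0) → x = 0)
    (hT' : Skew Q' T') (hnil : IsNilpotent T')
    (hnd' : ∀ x, (∀ y, polar Q' x y = 0) → x = 0)
    (h' : Frm Q' T' m l δ' v' w') (hC : Cmb m l k lam chi c s) (h0 : psi δ0 = -1) {a : ℕ}
    (ha : 0 < (-1) ^ a * ∑ x, psi (Q x)) {d : Finset ℕ} (hd : d ⊆ BB k lam chi)
    (hda : (-1 : ℤ) ^ d.card = (-1) ^ a) :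
    ∃ (T : Module.End F V) (v w : P → V), Skew Q T ∧ IsNilpotent T ∧
      QuadraticForm.IsScalarExtension Q T Q' T' ∧ Frm Q T m l (dcan δ0 c s d) v w := by
  classical
  obtain ⟨w1, h1⟩ := h'.shift hT' (fun p => algebraMap F K (dcan δ0 c s d p))
    (fun p hp => by
      have : dcan δ0 c s d p = 0 := by
        unfold dcan
        rw [if_neg]
        rintro ⟨-, h3⟩
        have h4 := hd h3
        simp only [BB, Finset.mem_filter] at h4
        exact h4.2.2 (by rw [← hC.lc, ← hC.mc, hp])
      rw [this, map_zero])
    (fun p => by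
      obtain ⟨y, hy⟩ := as_solve (algebraMap F K (dcan δ0 c s d p) - δ' p)
      exact ⟨y, by linear_combination hy⟩)
  obtain ⟨Q0, T0, v0, w0, hs0, hnil0, hnd0, hf0⟩ := exists_model hT' hnil hnd' h1
  have hn0 : Module.finrank F (Idx m → F) = 2 * n := by rw [hf0.dim, ← h'.dim, hn']
  have hsg := hf0.sign0 h0 hs0 hC (hd.trans BB_sub)
  rw [hda] at hsg
  obtain ⟨g, hg⟩ := isom_of_sign hn0 hn hnd0 hnd hsg ha
  let T : Module.End F V := g.toLinearMap ∘ₗ T0 ∘ₗ g.symm.toLinearMap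
  have hgT : ∀ x, g (T0 x) = T (g x) := fun x => by simp [T]
  have hpg : ∀ x y, polar Q (g x) (g y) = polar Q0 x y := fun x y => by
    simp only [polar, ← map_add, hg]
  have hT : Skew Q T := fun x => by
    obtain ⟨y, rfl⟩ := g.surjective x
    rw [← hgT, hpg, hs0]
  have hpow : ∀ N x, (T ^ N) (g x) = g ((T0 ^ N) x) := fun N x =>
    semi_pow (σ := g.toLinearMap) hgT N x
  have hF := hf0.push (f := RingHom.id F) g.toLinearMap hg hgT hT (by rw [hn0, hn])
  refine ⟨T, _, _, hT, ?_, hF.isoExt hT hT' h1, hF⟩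
  obtain ⟨N, hN⟩ := hnil0
  refine ⟨N, LinearMap.ext fun x => ?_⟩
  obtain ⟨y, rfl⟩ := g.surjective x
  rw [hpow, hN]; simp

lemma count {n : ℕ} [NeZero n] (hn : Module.finrank F V = 2 * n)
    (hn' : Module.finrank K V' = 2 * n) (hnd : ∀ x, (∀ y, polar Q x y = 0) → x = 0)
    (hT' : Skew Q' T') (hnil : IsNilpotent T')
    (hnd' : ∀ x, (∀ y, polar Q' x y = 0) → x = 0)
    (h' : Frm Q' T' m l δ' v' w') (hs : Sat m l) (hC : Cmb m l k lam chi c s)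
    (h0 : psi δ0 = -1) {a : ℕ}
    (ha : 0 < (-1) ^ a * ∑ x, psi (Q x)) :
    Nat.card (Quot fun x y :
          {S : Module.End F V // Q.mem_oLie S ∧ IsNilpotent S ∧
            QuadraticForm.IsScalarExtension Q S Q' T'} =>
        Q.OConj x.1 y.1) =
      ((BB k lam chi).powerset.filter fun d => (-1 : ℤ) ^ d.card = (-1) ^ a).card := by
  classical
  have key : ∀ S : {S : Module.End F V // Q.mem_oLie S ∧ IsNilpotent S ∧
      QuadraticForm.IsScalarExtension Q S Q' T'}, ∃ d, d ⊆ BB k lam chi ∧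
      ∃ v w, Frm Q S.1 m l (dcan δ0 c s d) v w := by
    rintro ⟨S, hS, hSn, hx⟩
    obtain ⟨δ, v, w, h⟩ := exists_desc perfF hS.1 hSn hnd hT' h' hs hx
    obtain ⟨d, hd, w', h2⟩ := h.reduce perfF δ0 (delta_or h0) hS.1 hC
    exact ⟨d, hd, v, w', h2⟩
  choose D hD v w hF using key
  have hDs : ∀ S, (-1 : ℤ) ^ (D S).card = (-1) ^ a := fun S =>
    neg_one_pow_sign ((hF S).sign0 h0 S.2.1.1 hC ((hD S).trans BB_sub)) ha
  let f : (Quot fun x y : {S : Module.End F V // Q.mem_oLie S ∧ IsNilpotent S ∧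
            QuadraticForm.IsScalarExtension Q S Q' T'} => Q.OConj x.1 y.1) →
      ((BB k lam chi).powerset.filter fun d => (-1 : ℤ) ^ d.card = (-1) ^ a) :=
    Quot.lift (fun S => ⟨D S, by
      rw [Finset.mem_filter, Finset.mem_powerset]; exact ⟨hD S, hDs S⟩⟩)
      (fun S S2 h => Subtype.ext
        ((hF S).unique h0 S.2.1.1 S2.2.1.1 hC (hD S) (hD S2) (hF S2) h))
  have hf : Function.Bijective f := by
    constructor
    · rintro ⟨S⟩ ⟨S2⟩ h
      have e : D S = D S2 := congrArg Subtype.val h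
      refine Quot.sound ?_
      have h1 := hF S
      rw [e] at h1
      exact h1.conj S.2.1.1 S2.2.1.1 (hF S2)
    · rintro ⟨d, hd⟩
      rw [Finset.mem_filter, Finset.mem_powerset] at hd
      obtain ⟨T, v1, w1, h1, h2, h3, h4⟩ :=
        realize hn hn' hnd hT' hnil hnd' h' hC h0 ha hd.1 hd.2
      let S : {S : Module.End F V // Q.mem_oLie S ∧ IsNilpotent S ∧
            QuadraticForm.IsScalarExtension Q S Q' T'} :=
        ⟨T, ⟨h1, (LinearMap.isNilpotent_trace_of_isNilpotent h2).eq_zero⟩, h2, h3⟩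
      refine ⟨Quot.mk _ S, Subtype.ext ?_⟩
      change D S = d
      refine (hF S).unique h0 h1 h1 hC (hD S) hd.1 h4 ⟨LinearEquiv.refl F V, fun _ => rfl, ?_⟩
      ext x; rfl
  rw [Nat.card_eq_of_bijective f hf]
  rw [Nat.card_eq_fintype_card, Fintype.card_coe]

lemma sign_count {B : Finset ℕ} (hB : B.Nonempty) (a : ℕ) :
    (B.powerset.filter fun d => (-1 : ℤ) ^ d.card = (-1) ^ a).card = 2 ^ (B.card - 1) := by
  have h1 := Finset.sum_powerset_neg_one_pow_card_of_nonempty hB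
  have h2 := Finset.card_powerset B
  have h3 : ∑ d ∈ B.powerset, (1 + (-1 : ℤ) ^ a * (-1) ^ d.card) =
      2 * ((B.powerset.filter fun d => (-1 : ℤ) ^ d.card = (-1) ^ a).card : ℤ) := by
    rw [Finset.card_filter, Nat.cast_sum, Finset.mul_sum]
    refine Finset.sum_congr rfl fun d _ => ?_
    rcases neg_one_pow_eq_or ℤ a with h | h <;> rcases neg_one_pow_eq_or ℤ d.card with h' | h' <;>
      rw [h, h'] <;> norm_num
  rw [Finset.sum_add_distrib, ← Finset.mul_sum, h1] at h3
  simp only [Finset.sum_const, h2, nsmul_eq_mul, mul_one, mul_zero, add_zero] at h3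
  obtain ⟨r, hr⟩ := Nat.exists_eq_succ_of_ne_zero hB.card_pos.ne'
  rw [hr] at h3 ⊢
  rw [Nat.succ_sub_one]
  rw [pow_succ] at h3
  push_cast at h3
  zify
  linarith

lemma BB_nonempty (hC : Cmb m l k lam chi c s) (h : ∃ i < k, 2 * chi i ≠ lam i) :
    (BB k lam chi).Nonempty := by
  classical
  let A := (Finset.range k).filter fun i => 2 * chi i ≠ lam i
  have hA : A.Nonempty := by
    obtain ⟨i, hi, h⟩ := h
    exact ⟨i, by simp [A, hi, h]⟩
  have hm := A.max'_mem hA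
  set i := A.max' hA with hi
  have hm' := hm
  simp only [A, Finset.mem_filter, Finset.mem_range] at hm'
  refine ⟨i, ?_⟩
  simp only [BB, Finset.mem_filter, Finset.mem_range]
  refine ⟨hm'.1, ?_, hm'.2⟩
  split_ifs with hk
  · have h1 : 2 * chi (i + 1) = lam (i + 1) := by
      by_contra hcon
      have : i + 1 ≤ i := A.le_max' (i + 1) (by simp [A, hk, hcon])
      omega
    have := hC.sub i (i + 1) (by omega) hk
    omega
  · have := hC.lm i hm'.1
    omega

end count
end OrthoNil

/-- Let `F` be a finite field of characteristic 2, and `(V̄, Q̄, T̄)` a `2n`-dimensional form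
module over the algebraic closure of `F` with symbol `(λ_i, χ_i, m_i)_{1 ≤ i ≤ k}`.  For
`ε ∈ {+, -}` let `N^ε` be the set of nilpotent `T' ∈ 𝔬^ε_{2n}(F)` whose scalar extension
is isomorphic to `(V̄, T̄)`.  (a) If `χ_i = λ_i / 2` for all `i`, then `N^+` is a single
`O^+_{2n}(F)`-orbit.  (b) Otherwise `N^+` is the union of exactly `2^{n₂ - 1}`
`O^+_{2n}(F)`-orbits and `N^-` is the union of exactly `2^{n₂ - 1}` `O^-_{2n}(F)`-orbits. -/
theorem card_orbits_in_geometric_class_even_orthogonal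
    (F : Type*) [Field F] [Fintype F] [CharP F 2]
    (n : ℕ) (hn : 1 ≤ n)
    (V' : Type*) [AddCommGroup V'] [Module (AlgebraicClosure F) V']
    [FiniteDimensional (AlgebraicClosure F) V']
    (Q' : QuadraticForm (AlgebraicClosure F) V') (T' : Module.End (AlgebraicClosure F) V')
    (hdim' : Module.finrank (AlgebraicClosure F) V' = 2 * n)
    (hQ' : Q'.IsNondegenerateFormSpace) (hT' : Q'.mem_oLie T') (hT'nil : IsNilpotent T')
    (k : ℕ) (lam mult chi : ℕ → ℕ) (hsymb : Q'.IsSymbolOf T' k lam mult chi)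
    -- the plus-type space `V^+` over `F`, of Witt index `n`
    (Vp : Type*) [AddCommGroup Vp] [Module F Vp] [FiniteDimensional F Vp]
    (Qp : QuadraticForm F Vp) (hdimp : Module.finrank F Vp = 2 * n)
    (hQp : Qp.IsNondegenerateFormSpace) (hWp : Qp.HasTotallySingularSubspace n)
    -- the minus-type space `V^-` over `F`, of Witt index `n - 1`
    (Vm : Type*) [AddCommGroup Vm] [Module F Vm] [FiniteDimensional F Vm]
    (Qm : QuadraticForm F Vm) (hdimm : Module.finrank F Vm = 2 * n)
    (hQm : Qm.IsNondegenerateFormSpace) (hWm : Qm.HasTotallySingularSubspace (n - 1))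
    (hWm' : ¬ Qm.HasTotallySingularSubspace n) :
    ((∀ i < k, 2 * chi i = lam i) →
      Nat.card (Quot fun x y :
          {S : Module.End F Vp // Qp.mem_oLie S ∧ IsNilpotent S ∧
            QuadraticForm.IsScalarExtension Qp S Q' T'} =>
        Qp.OConj x.1 y.1) = 1) ∧
    ((∃ i < k, 2 * chi i ≠ lam i) →
      Nat.card (Quot fun x y :
          {S : Module.End F Vp // Qp.mem_oLie S ∧ IsNilpotent S ∧
            QuadraticForm.IsScalarExtension Qp S Q' T'} =>
        Qp.OConj x.1 y.1) = 2 ^ (symbolN2 k lam chi - 1) ∧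
      Nat.card (Quot fun x y :
          {S : Module.End F Vm // Qm.mem_oLie S ∧ IsNilpotent S ∧
            QuadraticForm.IsScalarExtension Qm S Q' T'} =>
        Qm.OConj x.1 y.1) = 2 ^ (symbolN2 k lam chi - 1)) := by
  classical
  have : NeZero n := ⟨by omega⟩
  have : CharP (AlgebraicClosure F) 2 :=
    charP_of_injective_algebraMap (algebraMap F (AlgebraicClosure F)).injective 2
  have hnd' := OrthoNil.nondeg_of hQ' hdim'
  have hndp := OrthoNil.nondeg_of hQp hdimp
  have hndm := OrthoNil.nondeg_of hQm hdimm
  have : Finite Vp := Module.finite_of_finite F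
  have : Finite Vm := Module.finite_of_finite F
  let : Fintype Vp := Fintype.ofFinite Vp
  let : Fintype Vm := Fintype.ofFinite Vm
  have hTs : OrthoNil.Skew Q' T' := hT'.1
  obtain ⟨P, iF, iD, m, l, δ, v, w, h', hs⟩ := OrthoNil.exists_sat
    (fun x : AlgebraicClosure F => IsAlgClosed.exists_pow_nat_eq x (by norm_num : 0 < 2))
    hTs hT'nil hnd'
  have : Nonempty P := by
    by_contra hcon
    rw [not_nonempty_iff] at hcon
    have := h'.dim
    rw [hdim', Finset.univ_eq_empty, Finset.sum_empty] at this
    omega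
  obtain ⟨c, s, hC⟩ := h'.cmb hTs hs hsymb
  obtain ⟨δ0, h0⟩ := OrthoNil.exists_delta F
  have hp : 0 < (-1) ^ 0 * ∑ x, OrthoNil.psi (Qp x) := by
    simpa using OrthoNil.gamma_pos_of_ts hdimp hndp hWp
  have hm : 0 < (-1) ^ 1 * ∑ x, OrthoNil.psi (Qm x) := by
    obtain ⟨d, hd, v1, w1, h1⟩ := OrthoNil.zero_frm h0 hdimm hndm
    have hs1 := h1.sign0 h0 OrthoNil.skew_zero OrthoNil.cmb_one (by simpa using hd)
    have hng : ¬ 0 < ∑ x, OrthoNil.psi (Qm x) := fun h =>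
      hWm' (OrthoNil.ts_of_gamma_pos hdimm hndm h)
    rcases neg_one_pow_eq_or ℤ d.card with h | h <;> rw [h] at hs1
    · omega
    · simpa using hs1
  have cp := OrthoNil.count hdimp hdim' hndp hTs hT'nil hnd' h' hs hC h0 hp
  have cm := OrthoNil.count hdimm hdim' hndm hTs hT'nil hnd' h' hs hC h0 hm
  refine ⟨fun ha => ?_, fun hb => ?_⟩
  · rw [cp]
    have : OrthoNil.BB k lam chi = ∅ := by
      refine Finset.filter_false_of_mem fun i hi => ?_
      rintro ⟨-, h⟩
      exact h (ha i (Finset.mem_range.1 hi))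
    rw [this, Finset.powerset_empty, Finset.filter_singleton]
    simp
  · have hB := OrthoNil.BB_nonempty hC hb
    exact ⟨by rw [cp, OrthoNil.sign_count hB]; rfl, by rw [cm, OrthoNil.sign_count hB]; rfl⟩
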